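/- arXiv:1105.0420 — 5 statements merged into one kernel-verified Lean document; each statement's English description precedes it below -/
import Mathlib

section
/- Let C be a triangulated category and let {A_m ⊆ C : m ∈ ℤ} be a family of semi-simple abelian full subcategories such that the smallest strictly full triangulated subcategory of C containing ∪_{m∈ℤ} Obj A_m is C itself, and A_m ⊥ A_j[s] for all m, j, s ∈ ℤ such that either s < 0, or s > m − j, or (s = 0 and m > j). Then there exist a bounded weight structure w and a bounded t-structure t on C which are transversal, such that C_{w=0} consists exactly of the finite direct sums of objects X_m[-m] with X_m ∈ A_m, and the heart Ht is the smallest extension-stable full subcategory of C containing all A_m. -/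
namespace PaperWeights

open CategoryTheory CategoryTheory.Limits CategoryTheory.Pretriangulated CategoryTheory.Triangulated

universe v u

variable (C : Type u) [Category.{v} C] [HasZeroObject C] [Preadditive C] [HasShift C ℤ]
  [∀ n : ℤ, (shiftFunctor C n).Additive] [Pretriangulated C]

/-- A class of objects of a triangulated category is *extension-stable* if for every
distinguished triangle `A ⟶ B ⟶ C`, `A ∈ D` and `C ∈ D` imply `B ∈ D`. -/
def ExtensionStable (D : Set C) : Prop :=
  ∀ T : Triangle C, (T ∈ distTriang C) → T.obj₁ ∈ D → T.obj₃ ∈ D → T.obj₂ ∈ D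

/-- The pair of classes `(le, ge)`, playing the roles of `C_{w≤0}` and `C_{w≥0}`,
defines a weight structure on the triangulated category `C`. -/
structure IsWeightStructure (le ge : Set C) : Prop where
  retract_le : ∀ ⦃X Y : C⦄ (s : X ⟶ Y) (r : Y ⟶ X), s ≫ r = 𝟙 X → Y ∈ le → X ∈ le
  retract_ge : ∀ ⦃X Y : C⦄ (s : X ⟶ Y) (r : Y ⟶ X), s ≫ r = 𝟙 X → Y ∈ ge → X ∈ ge
  zero_le : ∀ ⦃X : C⦄, IsZero X → X ∈ le
  zero_ge : ∀ ⦃X : C⦄, IsZero X → X ∈ ge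
  sum_le : ∀ ⦃X Y : C⦄ (b : BinaryBicone X Y), b.IsBilimit → X ∈ le → Y ∈ le → b.pt ∈ le
  sum_ge : ∀ ⦃X Y : C⦄ (b : BinaryBicone X Y), b.IsBilimit → X ∈ ge → Y ∈ ge → b.pt ∈ ge
  shift_le : ∀ ⦃X : C⦄, X ∈ le → (X⟦(-1 : ℤ)⟧) ∈ le
  shift_ge : ∀ ⦃X : C⦄, X ∈ ge → (X⟦(1 : ℤ)⟧) ∈ ge
  orthogonal : ∀ ⦃X Y : C⦄, X ∈ le → Y ∈ ge → ∀ f : X ⟶ (Y⟦(1 : ℤ)⟧), f = 0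
  exists_decomp : ∀ M : C, ∃ (B A : C) (f : B ⟶ M) (g : M ⟶ A) (h : A ⟶ B⟦(1 : ℤ)⟧),
    B ∈ le ∧ (A⟦(-1 : ℤ)⟧) ∈ ge ∧ (Triangle.mk f g h ∈ distTriang C)

/-- The shift `P[i]` of a class of objects: `X ∈ P[i]` iff `X⟦-i⟧ ∈ P`.
For a weight structure this gives `C_{w≤i} = C_{w≤0}[i]` and `C_{w≥i} = C_{w≥0}[i]`. -/
def shiftedClass (P : Set C) (i : ℤ) : Set C := fun X => (X⟦(-i)⟧) ∈ P

/-- `C_{w=i} = C_{w≤i} ∩ C_{w≥i}`. -/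
def wEq (le ge : Set C) (i : ℤ) : Set C := shiftedClass C le i ∩ shiftedClass C ge i

/-- Boundedness of a weight structure. -/
def WBounded (le ge : Set C) : Prop :=
  ∀ X : C, (∃ i : ℤ, X ∈ shiftedClass C le i) ∧ (∃ i : ℤ, X ∈ shiftedClass C ge i)

/-- The class `C^{t=0}` of a `t`-structure. -/
def heartSet (t : TStructure C) : Set C := fun X => t.le 0 X ∧ t.ge 0 X

/-- The heart of a `t`-structure, as a full subcategory. -/
abbrev THeart (t : TStructure C) := ObjectProperty.FullSubcategory (fun X : C => X ∈ heartSet C t)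

/-- The inclusion of the heart. -/
abbrev heartIncl (t : TStructure C) : THeart C t ⥤ C :=
  ObjectProperty.ι (fun X : C => X ∈ heartSet C t)

/-- Boundedness of a `t`-structure. -/
def TBounded (t : TStructure C) : Prop :=
  ∀ X : C, (∃ n : ℤ, t.le n X) ∧ (∃ n : ℤ, t.ge n X)

/-- A *nice decomposition* of `X ∈ C^{t=0}` for `m ∈ ℤ`: a distinguished triangle
`w_{≤m}X ⟶ X ⟶ w_{≥m+1}X ⟶ (w_{≤m}X)[1]` with `w_{≤m}X ∈ C_{w≤m} ∩ C^{t=0}` and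
`w_{≥m+1}X ∈ C_{w≥m+1} ∩ C^{t=0}`. -/
def NiceDecomp (le ge : Set C) (t : TStructure C) (m : ℤ) (X : C) : Prop :=
  ∃ (W B : C) (f : W ⟶ X) (g : X ⟶ B) (h : B ⟶ W⟦(1 : ℤ)⟧),
    (Triangle.mk f g h ∈ distTriang C) ∧
    W ∈ shiftedClass C le m ∧ B ∈ shiftedClass C ge (m + 1) ∧
    W ∈ heartSet C t ∧ B ∈ heartSet C t

/-- `t` and `w` are transversal: every object of the heart admits a nice
decomposition for every `m`. -/
def Transversal (le ge : Set C) (t : TStructure C) : Prop :=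
  ∀ X ∈ heartSet C t, ∀ m : ℤ, NiceDecomp C le ge t m X

/-- A class of objects `P` of a category (with zero morphisms and finite
biproducts) is a *semi-simple abelian full subcategory* if it is closed under
isomorphisms and there is a family `S` of nonzero objects of `P` satisfying
Schur's property (every nonzero morphism between members of `S` is an
isomorphism) such that `P` consists exactly of the finite direct sums of
members of `S`. -/
def IsSemisimpleSub {A : Type*} [Category A] [HasZeroMorphisms A]
    [HasFiniteBiproducts A] (P : Set A) : Prop :=
  (∀ ⦃X Y : A⦄, (X ≅ Y) → X ∈ P → Y ∈ P) ∧
  ∃ S : Set A, S ⊆ P ∧ (∀ X ∈ S, ¬ IsZero X) ∧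
    (∀ X ∈ S, ∀ Y ∈ S, ∀ f : X ⟶ Y, f = 0 ∨ IsIso f) ∧
    (∀ X : A, X ∈ P ↔ ∃ (n : ℕ) (F : Fin n → A),
      (∀ i : Fin n, F i ∈ S) ∧ Nonempty (X ≅ ⨁ F))
/-- The smallest strictly full triangulated subcategory of `C` containing a
class `E` of objects. -/
inductive TriaClosure (E : Set C) : C → Prop
  | base {X : C} (hX : X ∈ E) : TriaClosure E X
  | iso {X Y : C} (e : X ≅ Y) (hX : TriaClosure E X) : TriaClosure E Y
  | shift {X : C} (n : ℤ) (hX : TriaClosure E X) : TriaClosure E (X⟦n⟧)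
  | ext {T : Triangle C} (hT : T ∈ distTriang C) (h₁ : TriaClosure E T.obj₁)
      (h₃ : TriaClosure E T.obj₃) : TriaClosure E T.obj₂

/-- The smallest extension-stable strictly full subcategory of `C` containing a
class `E` of objects. -/
inductive ExtClosure (E : Set C) : C → Prop
  | base {X : C} (hX : X ∈ E) : ExtClosure E X
  | iso {X Y : C} (e : X ≅ Y) (hX : ExtClosure E X) : ExtClosure E Y
  | ext {T : Triangle C} (hT : T ∈ distTriang C) (h₁ : ExtClosure E T.obj₁)
      (h₃ : ExtClosure E T.obj₃) : ExtClosure E T.obj₂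


set_option linter.unusedSectionVars false
set_option linter.unusedSimpArgs false
set_option linter.unusedVariables false

section Part1

variable {C : Type u} [Category.{v} C] [HasZeroObject C] [Preadditive C] [HasShift C ℤ]
  [∀ n : ℤ, (shiftFunctor C n).Additive] [Pretriangulated C]

/-- Distinguished triangle given by its three maps. -/
abbrev Tri {X Y Z : C} (f : X ⟶ Y) (g : Y ⟶ Z) (h : Z ⟶ X⟦(1 : ℤ)⟧) : Prop :=
  Triangle.mk f g h ∈ distTriang C

section
variable {X Y Z : C} {f : X ⟶ Y} {g : Y ⟶ Z} {h : Z ⟶ X⟦(1 : ℤ)⟧}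

lemma Tri.z12 (H : Tri f g h) : f ≫ g = 0 := comp_distTriang_mor_zero₁₂ _ H
lemma Tri.z23 (H : Tri f g h) : g ≫ h = 0 := comp_distTriang_mor_zero₂₃ _ H
lemma Tri.z31 (H : Tri f g h) : h ≫ f⟦(1 : ℤ)⟧' = 0 := comp_distTriang_mor_zero₃₁ _ H

lemma Tri.lift2 (H : Tri f g h) {T : C} (x : T ⟶ Y) (hx : x ≫ g = 0) : ∃ y : T ⟶ X, x = y ≫ f :=
  Triangle.coyoneda_exact₂ _ H x hx
lemma Tri.lift3 (H : Tri f g h) {T : C} (x : T ⟶ Z) (hx : x ≫ h = 0) : ∃ y : T ⟶ Y, x = y ≫ g :=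
  Triangle.coyoneda_exact₃ _ H x hx
lemma Tri.lift1 (H : Tri f g h) {T : C} (x : T ⟶ X⟦(1 : ℤ)⟧) (hx : x ≫ f⟦(1 : ℤ)⟧' = 0) :
    ∃ y : T ⟶ Z, x = y ≫ h :=
  Triangle.coyoneda_exact₁ _ H x hx
lemma Tri.desc2 (H : Tri f g h) {T : C} (x : Y ⟶ T) (hx : f ≫ x = 0) : ∃ y : Z ⟶ T, x = g ≫ y :=
  Triangle.yoneda_exact₂ _ H x hx
lemma Tri.desc3 (H : Tri f g h) {T : C} (x : Z ⟶ T) (hx : g ≫ x = 0) :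
    ∃ y : X⟦(1 : ℤ)⟧ ⟶ T, x = h ≫ y :=
  Triangle.yoneda_exact₃ _ H x hx
lemma Tri.rot (H : Tri f g h) : Tri g h (-f⟦(1 : ℤ)⟧') := rot_of_distTriang _ H
/-- shifted triangle up to sign, exactness -/
lemma Tri.lift2s (H : Tri f g h) {T : C} (x : T ⟶ Y⟦(1 : ℤ)⟧) (hx : x ≫ g⟦(1 : ℤ)⟧' = 0) :
    ∃ y : T ⟶ X⟦(1 : ℤ)⟧, x = y ≫ f⟦(1 : ℤ)⟧' := by
  obtain ⟨y, hy⟩ := H.rot.lift1 x hx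
  exact ⟨-y, by simpa using hy⟩
lemma Tri.desc1 (H : Tri f g h) {T : C} (x : X⟦(1 : ℤ)⟧ ⟶ T) (hx : h ≫ x = 0) :
    ∃ y : Y⟦(1 : ℤ)⟧ ⟶ T, x = f⟦(1 : ℤ)⟧' ≫ y := by
  obtain ⟨y, hy⟩ := H.rot.desc3 x hx
  exact ⟨-y, by simpa using hy⟩

lemma Tri.iso1 (H : Tri f g h) {X' : C} (e : X' ≅ X) :
    Tri (e.hom ≫ f) g (h ≫ e.inv⟦(1 : ℤ)⟧') := by
  refine isomorphic_distinguished _ H _ (Triangle.isoMk _ _ e (Iso.refl _) (Iso.refl _) ?_ ?_ ?_)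
  · change (e.hom ≫ f) ≫ 𝟙 Y = e.hom ≫ f; simp
  · change g ≫ 𝟙 Z = 𝟙 Y ≫ g; simp
  · change (h ≫ e.inv⟦(1 : ℤ)⟧') ≫ e.hom⟦(1 : ℤ)⟧' = 𝟙 Z ≫ h; simp [← Functor.map_comp]

lemma Tri.iso2 (H : Tri f g h) {Y' : C} (e : Y' ≅ Y) :
    Tri (f ≫ e.inv) (e.hom ≫ g) h := by
  refine isomorphic_distinguished _ H _ (Triangle.isoMk _ _ (Iso.refl _) e (Iso.refl _) ?_ ?_ ?_)
  · change (f ≫ e.inv) ≫ e.hom = 𝟙 X ≫ f; simp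
  · change (e.hom ≫ g) ≫ 𝟙 Z = e.hom ≫ g; simp
  · change h ≫ (𝟙 X)⟦(1 : ℤ)⟧' = 𝟙 Z ≫ h; simp

lemma Tri.iso3 (H : Tri f g h) {Z' : C} (e : Z' ≅ Z) :
    Tri f (g ≫ e.inv) (e.hom ≫ h) := by
  refine isomorphic_distinguished _ H _ (Triangle.isoMk _ _ (Iso.refl _) (Iso.refl _) e ?_ ?_ ?_)
  · change f ≫ 𝟙 Y = 𝟙 X ≫ f; simp
  · change (g ≫ e.inv) ≫ e.hom = 𝟙 Y ≫ g; simp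
  · change (e.hom ≫ h) ≫ (𝟙 X)⟦(1 : ℤ)⟧' = e.hom ≫ h; simp

lemma tr3 {X' Y' Z' : C} {f' : X' ⟶ Y'} {g' : Y' ⟶ Z'} {h' : Z' ⟶ X'⟦(1 : ℤ)⟧} (H : Tri f g h)
    (H' : Tri f' g' h') (a : X ⟶ X') (b : Y ⟶ Y') (comm : f ≫ b = a ≫ f') :
    ∃ c : Z ⟶ Z', g ≫ c = b ≫ g' ∧ h ≫ a⟦(1 : ℤ)⟧' = c ≫ h' :=
  complete_distinguished_triangle_morphism _ _ H H' a b comm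
lemma tr3' {X' Y' Z' : C} {f' : X' ⟶ Y'} {g' : Y' ⟶ Z'} {h' : Z' ⟶ X'⟦(1 : ℤ)⟧} (H : Tri f g h)
    (H' : Tri f' g' h') (a : X ⟶ X') (c : Z ⟶ Z') (comm : h ≫ a⟦(1 : ℤ)⟧' = c ≫ h') :
    ∃ b : Y ⟶ Y', f ≫ b = a ≫ f' ∧ g ≫ c = b ≫ g' :=
  complete_distinguished_triangle_morphism₂ _ _ H H' a c comm
end

lemma isIso_of_inj_surj {X Y : C} (f : X ⟶ Y) (hi : ∀ {T : C} (x : T ⟶ X), x ≫ f = 0 → x = 0)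
    (hs : ∃ s : Y ⟶ X, s ≫ f = 𝟙 Y) : IsIso f := by
  obtain ⟨s, hs⟩ := hs
  refine ⟨s, ?_, hs⟩
  have : (f ≫ s - 𝟙 X) ≫ f = 0 := by simp [hs]
  exact sub_eq_zero.1 (hi _ this)

/-- `Hom(X,Y)=0`. -/
def Perp (X Y : C) : Prop := ∀ f : X ⟶ Y, f = 0

lemma Perp.isoL {X X' Y : C} (H : Perp X Y) (e : X ≅ X') : Perp X' Y := fun f => by
  have := H (e.hom ≫ f)
  simpa using congrArg (e.inv ≫ ·) this
lemma Perp.isoR {X Y Y' : C} (H : Perp X Y) (e : Y ≅ Y') : Perp X Y' := fun f => by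
  have := H (f ≫ e.inv)
  simpa using congrArg (· ≫ e.hom) this
lemma perp_zeroL {X Y : C} (h : IsZero X) : Perp X Y := fun _ => h.eq_of_src _ _
lemma perp_zeroR {X Y : C} (h : IsZero Y) : Perp X Y := fun _ => h.eq_of_tgt _ _
lemma Perp.retL {X X' Y : C} (H : Perp X Y) (s : X' ⟶ X) (r : X ⟶ X') (h : s ≫ r = 𝟙 _) :
    Perp X' Y := fun f => by
  have := H (r ≫ f)
  rw [← Category.id_comp f, ← h, Category.assoc, this, comp_zero]
lemma Perp.retR {X Y Y' : C} (H : Perp X Y) (s : Y' ⟶ Y) (r : Y ⟶ Y') (h : s ≫ r = 𝟙 _) :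
    Perp X Y' := fun f => by
  have := H (f ≫ s)
  rw [← Category.comp_id f, ← h, ← Category.assoc, this, zero_comp]
lemma Perp.unshift {X Y : C} {a : ℤ} (H : Perp (X⟦a⟧) (Y⟦a⟧)) : Perp X Y := fun f => by
  apply (shiftFunctor C a).map_injective
  simpa using H _
lemma Perp.shift {X Y : C} (H : Perp X Y) (a : ℤ) : Perp (X⟦a⟧) (Y⟦a⟧) := fun f => by
  obtain ⟨g, rfl⟩ := (shiftFunctor C a).map_surjective f
  rw [H g]; simp

section
variable {X Y Z W : C} {f : X ⟶ Y} {g : Y ⟶ Z} {h : Z ⟶ X⟦(1 : ℤ)⟧}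
lemma Perp.extR (H : Tri f g h) (h1 : Perp W X) (h3 : Perp W Z) : Perp W Y := fun x => by
  obtain ⟨y, rfl⟩ := H.lift2 x (h3 _)
  rw [h1 y, zero_comp]
lemma Perp.extL (H : Tri f g h) (h1 : Perp X W) (h3 : Perp Z W) : Perp Y W := fun x => by
  obtain ⟨y, rfl⟩ := H.desc2 x (h1 _)
  rw [h3 y, comp_zero]
lemma Perp.coneR (H : Tri f g h) (h2 : Perp W Y) (h1 : Perp W (X⟦(1 : ℤ)⟧)) : Perp W Z :=
  Perp.extR H.rot h2 h1
lemma Perp.coneL (H : Tri f g h) (h2 : Perp Y W) (h1 : Perp (X⟦(1 : ℤ)⟧) W) : Perp Z W :=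
  Perp.extL H.rot h2 h1
end

/-- Octahedron under a vanishing hypothesis. -/
theorem oct {X Y Z Cf Cg Ch : C} {f : X ⟶ Y} {g : Y ⟶ Z} {y1 : Y ⟶ Cf} {f3 : Cf ⟶ X⟦(1 : ℤ)⟧}
    {z1 : Z ⟶ Cg} {g3 : Cg ⟶ Y⟦(1 : ℤ)⟧} {z2 : Z ⟶ Ch} {h3 : Ch ⟶ X⟦(1 : ℤ)⟧}
    (Hf : Tri f y1 f3) (Hg : Tri g z1 g3) (Hh : Tri (f ≫ g) z2 h3)
    (hp : Perp (X⟦(1 : ℤ)⟧) Cg) :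
    ∃ (α : Cf ⟶ Ch) (β : Ch ⟶ Cg), y1 ≫ α = g ≫ z2 ∧ α ≫ h3 = f3 ∧ z2 ≫ β = z1 ∧
      β ≫ g3 = h3 ≫ f⟦(1 : ℤ)⟧' ∧ Tri α β (g3 ≫ y1⟦(1 : ℤ)⟧') := by
  obtain ⟨α, hα1, hα2⟩ := tr3 Hf Hh (𝟙 X) g (by simp)
  obtain ⟨β, hβ1, hβ2⟩ := tr3 Hh Hg f (𝟙 Z) (by simp)
  simp only [CategoryTheory.Functor.map_id, Category.comp_id, Category.id_comp] at hα1 hα2 hβ1 hβ2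
  obtain ⟨D, a, b, HD⟩ := distinguished_cocone_triangle₂ (g3 ≫ y1⟦(1 : ℤ)⟧')
  change Tri a b _ at HD
  obtain ⟨ζ, hζ1, hζ2⟩ := tr3' Hg HD y1 (𝟙 _) (by simp)
  simp only [Category.comp_id] at hζ1 hζ2
  obtain ⟨ψ, hψ⟩ := Hh.desc2 ζ (by
    rw [Category.assoc, hζ1, ← Category.assoc, Hf.z12, zero_comp])
  have hψb : ψ ≫ b = β := by
    have : z2 ≫ (ψ ≫ b - β) = 0 := by
      rw [Preadditive.comp_sub, ← Category.assoc, ← hψ, ← hζ2, hβ1, sub_self]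
    obtain ⟨γ, hγ⟩ := Hh.desc3 _ this
    rw [hp γ, comp_zero] at hγ
    exact sub_eq_zero.1 hγ
  obtain ⟨τ, hτ⟩ := Hf.desc3 (α ≫ ψ - a) (by
    rw [Preadditive.comp_sub, ← Category.assoc, hα1, Category.assoc, ← hψ, hζ1, sub_self])
  have hτb := hp (τ ≫ b)
  have e1 : α ≫ (ψ - h3 ≫ τ) = a := by
    rw [Preadditive.comp_sub, ← Category.assoc α h3, ← hα2, ← hτ]; abel
  have e2 : (ψ - h3 ≫ τ) ≫ b = β := by
    rw [Preadditive.sub_comp, Category.assoc, hτb, comp_zero, sub_zero, hψb]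
  set ψ' := ψ - h3 ≫ τ with hψ'
  have hc3 : (g3 ≫ y1⟦(1 : ℤ)⟧') ≫ α⟦(1 : ℤ)⟧' = 0 := by
    rw [Category.assoc, ← Functor.map_comp, hα1, Functor.map_comp, ← Category.assoc, Hg.z31,
      zero_comp]
  have ex1 : ∀ {T : C} (x : T ⟶ Ch), x ≫ β = 0 → ∃ w, x = w ≫ α := by
    intro T x hx
    obtain ⟨w, hw⟩ := Hf.lift1 (x ≫ h3) (by
      rw [Category.assoc, hβ2, ← Category.assoc, hx, zero_comp])
    obtain ⟨u, hu⟩ := Hh.lift3 (x - w ≫ α) (by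
      rw [Preadditive.sub_comp, hw, Category.assoc, ← hα2, sub_self])
    have hab : α ≫ β = 0 := by rw [← e2, ← Category.assoc, e1, HD.z12]
    obtain ⟨v, hv⟩ := Hg.lift2 u (by
      have : (x - w ≫ α) ≫ β = 0 := by simp [hx, hab]
      rw [hu, Category.assoc, hβ1] at this; exact this)
    refine ⟨w + v ≫ y1, ?_⟩
    rw [Preadditive.add_comp, Category.assoc, hα1, ← Category.assoc, ← hv, ← hu]; abel
  have ex2 : ∀ {T : C} (y : T ⟶ Cg), y ≫ (g3 ≫ y1⟦(1 : ℤ)⟧') = 0 → ∃ x, y = x ≫ β := by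
    intro T y hy
    obtain ⟨w, hw⟩ := Hf.lift2s (y ≫ g3) (by simpa using hy)
    obtain ⟨x, hx⟩ := Hh.lift1 w (by
      rw [Functor.map_comp, ← Category.assoc, ← hw, Category.assoc, Hg.z31, comp_zero])
    obtain ⟨u, hu⟩ := Hg.lift3 (y - x ≫ β) (by
      rw [Preadditive.sub_comp, hw, hx, Category.assoc, Category.assoc, hβ2, sub_self])
    refine ⟨x + u ≫ z2, ?_⟩
    rw [Preadditive.add_comp, Category.assoc, hβ1, ← hu]; abel
  have hiso : IsIso ψ' := by
    refine isIso_of_inj_surj _ ?_ ?_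
    · intro T x hx
      obtain ⟨w, rfl⟩ := ex1 x (by rw [← e2, ← Category.assoc, hx, zero_comp])
      rw [Category.assoc, e1] at hx
      obtain ⟨y, hy⟩ := HD.lift1 (w⟦(1 : ℤ)⟧') (by rw [← Functor.map_comp, hx, Functor.map_zero])
      apply (shiftFunctor C (1 : ℤ)).map_injective
      rw [Functor.map_comp, hy, Category.assoc, hc3, comp_zero, Functor.map_zero]
    · obtain ⟨x, hx⟩ := ex2 b HD.z23
      obtain ⟨w, hw⟩ := HD.lift2 (𝟙 _ - x ≫ ψ') (by
        rw [Preadditive.sub_comp, Category.assoc, e2, ← hx]; simp)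
      refine ⟨x + w ≫ α, ?_⟩
      rw [Preadditive.add_comp, Category.assoc, e1, ← hw]; abel
  refine ⟨α, β, hα1, hα2.symm, hβ1, hβ2.symm, ?_⟩
  have := HD.iso2 (asIso ψ')
  have e3 : a ≫ (asIso ψ').inv = α := by rw [← e1]; simp
  have e4 : (asIso ψ').hom ≫ b = β := e2
  rwa [e3, e4] at this

lemma tri_unshift {A W V : C} {a : A ⟶ W} {b : W ⟶ V⟦(1 : ℤ)⟧} {c : V⟦(1 : ℤ)⟧ ⟶ A⟦(1 : ℤ)⟧}
    (H : Tri a b c) : ∃ (W0 : C) (f : W0 ⟶ V) (g : V ⟶ A) (h : A ⟶ W0⟦(1 : ℤ)⟧),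
      Tri f g h ∧ Nonempty (W0⟦(1 : ℤ)⟧ ≅ W) := by
  have H2 := inv_rot_of_distTriang _ (inv_rot_of_distTriang _ H)
  let e : V ≅ (V⟦(1 : ℤ)⟧)⟦(-1 : ℤ)⟧ := ((shiftEquiv C (1 : ℤ)).unitIso.app V)
  exact ⟨_, _, _, _, Tri.iso2 H2 e, ⟨(shiftEquiv C (1 : ℤ)).counitIso.app W⟩⟩

lemma exists_cone {X Y : C} (f : X ⟶ Y) : ∃ (Z : C) (g : Y ⟶ Z) (h : Z ⟶ X⟦(1 : ℤ)⟧), Tri f g h :=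
  distinguished_cocone_triangle f
lemma exists_fiber {Y Z : C} (g : Y ⟶ Z) : ∃ (X : C) (f : X ⟶ Y) (h : Z ⟶ X⟦(1 : ℤ)⟧), Tri f g h :=
  distinguished_cocone_triangle₁ g

lemma Tri.shift {X Y Z : C} {f : X ⟶ Y} {g : Y ⟶ Z} {h : Z ⟶ X⟦(1 : ℤ)⟧} (H : Tri f g h) (a : ℤ) :
    ∃ (f' : X⟦a⟧ ⟶ Y⟦a⟧) (g' : Y⟦a⟧ ⟶ Z⟦a⟧) (h' : Z⟦a⟧ ⟶ (X⟦a⟧)⟦(1 : ℤ)⟧), Tri f' g' h' :=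
  ⟨_, _, _, Triangle.shift_distinguished _ H a⟩

lemma Tri.iso_of_zero1 {X Y Z : C} {f : X ⟶ Y} {g : Y ⟶ Z} {h : Z ⟶ X⟦(1 : ℤ)⟧} (H : Tri f g h)
    (hX : IsZero X) : IsIso g := (Triangle.isZero₁_iff_isIso₂ _ H).1 hX
lemma Tri.iso_of_zero3 {X Y Z : C} {f : X ⟶ Y} {g : Y ⟶ Z} {h : Z ⟶ X⟦(1 : ℤ)⟧} (H : Tri f g h)
    (hX : IsZero Z) : IsIso f := (Triangle.isZero₃_iff_isIso₁ _ H).1 hX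
lemma tri_id_zero (X : C) {Z : C} (hZ : IsZero Z) : Tri (𝟙 X) (0 : X ⟶ Z) 0 := by
  have H : Tri (𝟙 X) (0 : X ⟶ (HasZeroObject.zero' C).zero) 0 := contractible_distinguished X
  have := H.iso3 (hZ.iso (isZero_zero C))
  simpa using this

end Part1

section Part2

variable {C : Type u} [Category.{v} C] [HasZeroObject C] [Preadditive C] [HasShift C ℤ]
  [∀ n : ℤ, (shiftFunctor C n).Additive] [Pretriangulated C]

/-- `X` is a direct sum of `A` and `B`. -/
structure Dec (A B X : C) where
  i1 : A ⟶ X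
  i2 : B ⟶ X
  p1 : X ⟶ A
  p2 : X ⟶ B
  i1p1 : i1 ≫ p1 = 𝟙 A
  i2p2 : i2 ≫ p2 = 𝟙 B
  i1p2 : i1 ≫ p2 = 0
  i2p1 : i2 ≫ p1 = 0
  total : p1 ≫ i1 + p2 ≫ i2 = 𝟙 X

attribute [simp] Dec.i1p1 Dec.i2p2 Dec.i1p2 Dec.i2p1

namespace Dec
variable {A B X : C}
@[simp] lemma i1p1a (d : Dec A B X) {T : C} (f : A ⟶ T) : d.i1 ≫ d.p1 ≫ f = f := by
  rw [← Category.assoc, d.i1p1, Category.id_comp]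
@[simp] lemma i2p2a (d : Dec A B X) {T : C} (f : B ⟶ T) : d.i2 ≫ d.p2 ≫ f = f := by
  rw [← Category.assoc, d.i2p2, Category.id_comp]
@[simp] lemma i1p2a (d : Dec A B X) {T : C} (f : B ⟶ T) : d.i1 ≫ d.p2 ≫ f = 0 := by
  rw [← Category.assoc, d.i1p2, zero_comp]
@[simp] lemma i2p1a (d : Dec A B X) {T : C} (f : A ⟶ T) : d.i2 ≫ d.p1 ≫ f = 0 := by
  rw [← Category.assoc, d.i2p1, zero_comp]

lemma eq_src (d : Dec A B X) {T : C} (f : X ⟶ T) : f = d.p1 ≫ d.i1 ≫ f + d.p2 ≫ d.i2 ≫ f := by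
  have := congrArg (· ≫ f) d.total
  simpa using this.symm
lemma eq_tgt (d : Dec A B X) {T : C} (f : T ⟶ X) :
    f = (f ≫ d.p1) ≫ d.i1 + (f ≫ d.p2) ≫ d.i2 := by
  have := congrArg (f ≫ ·) d.total
  simpa using this.symm
lemma ext_src (d : Dec A B X) {T : C} {f g : X ⟶ T} (h1 : d.i1 ≫ f = d.i1 ≫ g)
    (h2 : d.i2 ≫ f = d.i2 ≫ g) : f = g := by
  rw [d.eq_src f, d.eq_src g, h1, h2]
lemma ext_tgt (d : Dec A B X) {T : C} {f g : T ⟶ X} (h1 : f ≫ d.p1 = g ≫ d.p1)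
    (h2 : f ≫ d.p2 = g ≫ d.p2) : f = g := by
  rw [d.eq_tgt f, d.eq_tgt g, h1, h2]

/-- transport along an iso -/
def iso (d : Dec A B X) {Y : C} (e : X ≅ Y) : Dec A B Y where
  i1 := d.i1 ≫ e.hom
  i2 := d.i2 ≫ e.hom
  p1 := e.inv ≫ d.p1
  p2 := e.inv ≫ d.p2
  i1p1 := by simp
  i2p2 := by simp
  i1p2 := by simp
  i2p1 := by simp
  total := by
    have := congrArg (fun t => e.inv ≫ t ≫ e.hom) d.total
    simpa using this

/-- symmetry -/
def symm (d : Dec A B X) : Dec B A X where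
  i1 := d.i2
  i2 := d.i1
  p1 := d.p2
  p2 := d.p1
  i1p1 := by simp
  i2p2 := by simp
  i1p2 := by simp
  i2p1 := by simp
  total := by rw [add_comm, d.total]

/-- image under the shift -/
def shift (d : Dec A B X) (a : ℤ) : Dec (A⟦a⟧) (B⟦a⟧) (X⟦a⟧) where
  i1 := d.i1⟦a⟧'
  i2 := d.i2⟦a⟧'
  p1 := d.p1⟦a⟧'
  p2 := d.p2⟦a⟧'
  i1p1 := by rw [← Functor.map_comp, d.i1p1, CategoryTheory.Functor.map_id]
  i2p2 := by rw [← Functor.map_comp, d.i2p2, CategoryTheory.Functor.map_id]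
  i1p2 := by rw [← Functor.map_comp, d.i1p2, Functor.map_zero]
  i2p1 := by rw [← Functor.map_comp, d.i2p1, Functor.map_zero]
  total := by
    rw [← Functor.map_comp, ← Functor.map_comp, ← Functor.map_add, d.total,
      CategoryTheory.Functor.map_id]

/-- unit -/
def unit (hA : IsZero A) (X : C) : Dec A X X where
  i1 := 0
  i2 := 𝟙 X
  p1 := 0
  p2 := 𝟙 X
  i1p1 := hA.eq_of_src _ _
  i2p2 := by simp
  i1p2 := by simp
  i2p1 := by simp
  total := by simp

/-- canonical biproduct -/
noncomputable def mk' (A B : C) : Dec A B (A ⊞ B) where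
  i1 := biprod.inl
  i2 := biprod.inr
  p1 := biprod.fst
  p2 := biprod.snd
  i1p1 := by simp
  i2p2 := by simp
  i1p2 := by simp
  i2p1 := by simp
  total := by simp [biprod.total]

/-- two decompositions of the same pieces are isomorphic -/
def uniq (d : Dec A B X) {Y : C} (d' : Dec A B Y) : X ≅ Y where
  hom := d.p1 ≫ d'.i1 + d.p2 ≫ d'.i2
  inv := d'.p1 ≫ d.i1 + d'.p2 ≫ d.i2
  hom_inv_id := by simp [d.total]
  inv_hom_id := by simp [d'.total]

lemma tri (d : Dec A B X) : Tri d.i1 d.p2 0 := by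
  have H : Tri (biprod.inl : A ⟶ A ⊞ B) biprod.snd 0 := binaryBiproductTriangle_distinguished A B
  have := H.iso2 (d.uniq (mk' A B))
  convert this using 2 <;> simp only [uniq, mk'] <;> simp

/-- isomorphism in the second variable -/
def iso2 (d : Dec A B X) {B' : C} (e : B ≅ B') : Dec A B' X where
  i1 := d.i1
  i2 := e.inv ≫ d.i2
  p1 := d.p1
  p2 := d.p2 ≫ e.hom
  i1p1 := by simp
  i2p2 := by simp
  i1p2 := by simp
  i2p1 := by simp
  total := by simp [d.total]

/-- reassociation -/
lemma assoc {A B X D Z : C} (d : Dec A B X) (e : Dec X D Z) {W : C} (w : Dec B D W) :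
    Nonempty (Dec A W Z) := by
  refine ⟨⟨d.i1 ≫ e.i1, w.p1 ≫ d.i2 ≫ e.i1 + w.p2 ≫ e.i2, e.p1 ≫ d.p1,
    e.p1 ≫ d.p2 ≫ w.i1 + e.p2 ≫ w.i2, ?_, ?_, ?_, ?_, ?_⟩⟩
  · simp
  · simp [w.total]
  · simp
  · simp
  · refine e.ext_src (d.ext_src ?_ ?_) ?_ <;> simp

end Dec

lemma tri_split_mono {X Y Z : C} {f : X ⟶ Y} {g : Y ⟶ Z} {h : Z ⟶ X⟦(1 : ℤ)⟧} (H : Tri f g h)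
    (r : Y ⟶ X) (hr : f ≫ r = 𝟙 X) : ∃ s : Z ⟶ Y, s ≫ g = 𝟙 Z := by
  have : h = 0 := by
    have e : h ≫ (f ≫ r)⟦(1 : ℤ)⟧' = h ≫ (𝟙 X)⟦(1 : ℤ)⟧' := by rw [hr]
    rw [Functor.map_comp, ← Category.assoc, H.z31, zero_comp, CategoryTheory.Functor.map_id,
      Category.comp_id] at e
    exact e.symm
  obtain ⟨s, hs⟩ := H.lift3 (𝟙 Z) (by rw [this, comp_zero])
  exact ⟨s, hs.symm⟩

lemma dec_of_splitEpi {X G : C} (p : X ⟶ G) (σ : G ⟶ X) (h : σ ≫ p = 𝟙 G) :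
    ∃ (X' : C) (d : Dec G X' X), d.i1 = σ ∧ d.p1 = p := by
  obtain ⟨X', j, c, H⟩ := exists_fiber p
  have hc : c = 0 := by
    rw [← Category.id_comp c, ← h, Category.assoc, H.z23, comp_zero]
  have : Mono j := Triangle.mono₁ _ H hc
  obtain ⟨q, hq⟩ := H.lift2 (𝟙 X - p ≫ σ) (by simp [h])
  refine ⟨X', ⟨σ, j, p, q, h, ?_, ?_, H.z12, ?_⟩, rfl, rfl⟩
  · rw [← cancel_mono j, Category.assoc, ← hq]
    simp only [Preadditive.comp_sub, Category.comp_id, Category.id_comp]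
    rw [← Category.assoc, H.z12]; simp
  · rw [← cancel_mono j, Category.assoc, ← hq]
    simp only [Preadditive.comp_sub, Category.comp_id, Category.id_comp]
    rw [← Category.assoc, h]; simp
  · rw [← hq]; abel

/-- finite direct sums of objects satisfying `D` -/
inductive FS (D : C → Prop) : C → Prop
  | zero {X : C} (h : IsZero X) : FS D X
  | cons {G X' X : C} (hG : D G) (h : FS D X') (d : Dec G X' X) : FS D X

section
variable {D : C → Prop}

lemma FS.single {G : C} (h : D G) : FS D G := 
  .cons h (.zero (isZero_zero C)) (Dec.unit (isZero_zero C) G).symm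

lemma FS.iso {X Y : C} (h : FS D X) (e : X ≅ Y) : FS D Y := by
  cases h with
  | zero h => exact .zero (h.of_iso e.symm)
  | cons hG h d => exact .cons hG h (d.iso e)

lemma FS.mono {D' : C → Prop} (hD : ∀ X, D X → D' X) {X : C} (h : FS D X) : FS D' X := by
  induction h with
  | zero h => exact .zero h
  | cons hG h d ih => exact .cons (hD _ hG) ih d

lemma FS.shift {D' : C → Prop} (a : ℤ) (hD : ∀ X, D X → D' (X⟦a⟧)) {X : C} (h : FS D X) :
    FS D' (X⟦a⟧) := by
  induction h with
  | zero h => exact .zero ((shiftFunctor C a).map_isZero h)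
  | cons hG h d ih => exact .cons (hD _ hG) ih (d.shift a)

lemma FS.perpL {Z : C} (hD : ∀ X, D X → Perp X Z) {X : C} (h : FS D X) : Perp X Z := by
  induction h with
  | zero h => exact perp_zeroL h
  | cons hG h d ih => exact Perp.extL d.tri (hD _ hG) ih

lemma FS.perpR {Z : C} (hD : ∀ X, D X → Perp Z X) {X : C} (h : FS D X) : Perp Z X := by
  induction h with
  | zero h => exact perp_zeroR h
  | cons hG h d ih => exact Perp.extR d.tri (hD _ hG) ih

lemma FS.sum {X Y Z : C} (hX : FS D X) (hY : FS D Y) (e : Dec X Y Z) : FS D Z := by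
  induction hX generalizing Y Z with
  | zero h => exact hY.iso ((Dec.unit h Y).uniq e)
  | @cons G X' X hG h d ih =>
    obtain ⟨d'⟩ := d.assoc e (Dec.mk' X' Y)
    exact .cons hG (ih hY (Dec.mk' X' Y)) d'

lemma FS.retract (hD : ∀ G, D G → ∀ f : G ⟶ G, f = 0 ∨ IsIso f) {c : C} (hc : FS D c) :
    ∀ {X : C} (f : X ⟶ c) (g : c ⟶ X), f ≫ g = 𝟙 X → FS D X := by
  induction hc with
  | zero h =>
    intro X f g hfg
    refine .zero ((IsZero.iff_id_eq_zero X).2 ?_)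
    rw [← hfg, h.eq_of_tgt f 0, zero_comp]
  | @cons G c1 c hG h d ih =>
    intro X f g hfg
    have e1 : f ≫ d.p1 ≫ d.i1 ≫ g + f ≫ d.p2 ≫ d.i2 ≫ g = 𝟙 X := by
      rw [← hfg]; conv_rhs => rw [d.eq_src g]
      simp
    rcases hD G hG (d.i1 ≫ g ≫ f ≫ d.p1) with h0 | h0
    · refine ih (f ≫ d.p2) (d.i2 ≫ g ≫ (𝟙 X + f ≫ d.p1 ≫ d.i1 ≫ g)) ?_
      have e2 : (f ≫ d.p1 ≫ d.i1 ≫ g) ≫ (f ≫ d.p1 ≫ d.i1 ≫ g) = 0 := by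
        have := congrArg (fun t => f ≫ d.p1 ≫ t ≫ d.i1 ≫ g) h0
        simpa using this
      have e3 : f ≫ d.p2 ≫ d.i2 ≫ g = 𝟙 X - f ≫ d.p1 ≫ d.i1 ≫ g := by rw [← e1]; abel
      have : (f ≫ d.p2) ≫ (d.i2 ≫ g ≫ (𝟙 X + f ≫ d.p1 ≫ d.i1 ≫ g))
         = (f ≫ d.p2 ≫ d.i2 ≫ g) ≫ (𝟙 X + f ≫ d.p1 ≫ d.i1 ≫ g) := by simp
      rw [this, e3, Preadditive.sub_comp, Preadditive.comp_add _ _ _ (f ≫ d.p1 ≫ d.i1 ≫ g), e2]; simp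
    · obtain ⟨X', d', h1, h2⟩ := dec_of_splitEpi (f ≫ d.p1) (inv (d.i1 ≫ g ≫ f ≫ d.p1) ≫ d.i1 ≫ g)
        (by rw [← IsIso.inv_hom_id (d.i1 ≫ g ≫ f ≫ d.p1)]; simp)
      refine .cons hG (ih (d'.i2 ≫ f ≫ d.p2) (d.i2 ≫ g ≫ d'.p2) ?_) d'
      have e3 : f ≫ d.p2 ≫ d.i2 ≫ g = 𝟙 X - f ≫ d.p1 ≫ d.i1 ≫ g := by rw [← e1]; abel
      have : (d'.i2 ≫ f ≫ d.p2) ≫ d.i2 ≫ g ≫ d'.p2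
         = d'.i2 ≫ (f ≫ d.p2 ≫ d.i2 ≫ g) ≫ d'.p2 := by simp
      rw [this, e3, Preadditive.sub_comp, Preadditive.comp_sub]
      have e4 : d'.i2 ≫ (f ≫ d.p1 ≫ d.i1 ≫ g) ≫ d'.p2 = 0 := by
        have := d'.i2p1
        rw [h2] at this
        have := congrArg (· ≫ d.i1 ≫ g ≫ d'.p2) this
        simpa using this
      rw [e4]; simp

lemma FS.retr (hS : ∀ G G', D G → D G' → ∀ f : G ⟶ G', f = 0 ∨ IsIso f)
    {G : C} (hG : D G) {c : C} (hc : FS D c) : ∀ (w : G ⟶ c), w ≠ 0 →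
    ∃ v, w ≫ v = 𝟙 G := by
  induction hc with
  | zero h => intro w hw; exact absurd (h.eq_of_tgt _ _) hw
  | @cons G' c1 c hG' h d ih =>
    intro w hw
    rcases hS _ _ hG hG' (w ≫ d.p1) with h0 | h0
    · obtain ⟨v, hv⟩ := ih (w ≫ d.p2) (fun h1 => hw (by rw [d.eq_tgt w, h0, h1]; simp))
      exact ⟨d.p2 ≫ v, by simpa using hv⟩
    · exact ⟨d.p1 ≫ inv (w ≫ d.p1), by rw [← Category.assoc]; simp⟩

lemma FS.split (hS : ∀ G G', D G → D G' → ∀ f : G ⟶ G', f = 0 ∨ IsIso f)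
    {c : C} (hc : FS D c) : ∀ {Z : C} (h : c ⟶ Z), ∃ (k i : C) (d : Dec k i c),
    FS D k ∧ FS D i ∧ d.i1 ≫ h = 0 ∧ ∀ T, D T → ∀ x : T ⟶ i, x ≫ d.i2 ≫ h = 0 → x = 0 := by
  induction hc with
  | @zero X h => 
    intro Z f
    exact ⟨X, X, Dec.unit h X, .zero h, .zero h, h.eq_of_src _ _, fun _ _ _ _ => h.eq_of_tgt _ _⟩
  | @cons G c1 c hG h1 e ih =>
    intro Z h
    obtain ⟨k1, i1, d1, hk, hi, e1, e2⟩ := ih (e.i2 ≫ h)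
    by_cases hv : ∃ v : G ⟶ i1, e.i1 ≫ h = v ≫ d1.i2 ≫ e.i2 ≫ h
    · obtain ⟨v, hv⟩ := hv
      let a := Dec.mk' G k1
      refine ⟨_, i1, ⟨a.p1 ≫ (e.i1 - v ≫ d1.i2 ≫ e.i2) + a.p2 ≫ d1.i1 ≫ e.i2, d1.i2 ≫ e.i2,
        e.p1 ≫ a.i1 + e.p2 ≫ d1.p1 ≫ a.i2, e.p1 ≫ v + e.p2 ≫ d1.p2, ?_, ?_, ?_, ?_, ?_⟩,
        .cons hG hk a, hi, ?_, ?_⟩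
      · refine a.ext_src ?_ ?_ <;> simp
      · simp
      · refine a.ext_src ?_ ?_ <;> simp
      · simp
      · refine e.ext_src ?_ (d1.ext_src ?_ ?_) <;> simp
      · refine a.ext_src ?_ ?_ <;> simp [e1, hv]
      · simpa using e2
    · let a := Dec.mk' G i1
      refine ⟨k1, _, ⟨d1.i1 ≫ e.i2, a.p1 ≫ e.i1 + a.p2 ≫ d1.i2 ≫ e.i2,
        e.p2 ≫ d1.p1, e.p1 ≫ a.i1 + e.p2 ≫ d1.p2 ≫ a.i2, ?_, ?_, ?_, ?_, ?_⟩,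
        hk, .cons hG hi a, ?_, ?_⟩
      · simp
      · refine a.ext_src ?_ ?_ <;> simp
      · simp
      · simp
      · refine e.ext_src ?_ (d1.ext_src ?_ ?_) <;> simp
      · simp [e1]
      · intro T hT x hx
        have hx' : (x ≫ a.p1) ≫ e.i1 ≫ h + (x ≫ a.p2) ≫ d1.i2 ≫ e.i2 ≫ h = 0 := by
          simpa using hx
        rcases hS _ _ hT hG (x ≫ a.p1) with h0 | h0
        · rw [h0, zero_comp, zero_add] at hx'
          rw [a.eq_tgt x, h0, e2 T hT _ hx']; simp
        · exfalso; apply hv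
          refine ⟨- (inv (x ≫ a.p1) ≫ x ≫ a.p2), ?_⟩
          have := congrArg (inv (x ≫ a.p1) ≫ ·) hx'
          simp only [Preadditive.comp_add, IsIso.inv_hom_id_assoc, comp_zero] at this
          rw [eq_neg_of_add_eq_zero_left this]; simp

lemma FS.injSplit (hS : ∀ G G', D G → D G' → ∀ f : G ⟶ G', f = 0 ∨ IsIso f)
    {i : C} (hi : FS D i) : ∀ {c : C}, FS D c → ∀ u : i ⟶ c,
    (∀ T, D T → ∀ x : T ⟶ i, x ≫ u = 0 → x = 0) → ∃ r, u ≫ r = 𝟙 i := by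
  induction hi with
  | zero h => intro c hc u hu; exact ⟨0, h.eq_of_src _ _⟩
  | @cons G i1 i hG h e ih =>
    intro c hc u hu
    by_cases h0 : e.i1 ≫ u = 0
    · have h00 := hu _ hG _ h0
      obtain ⟨r, hr⟩ := ih hc (e.i2 ≫ u) (fun T hT x hx => by
        have := hu T hT (x ≫ e.i2) (by simpa using hx)
        simpa using congrArg (· ≫ e.p2) this)
      refine ⟨r ≫ e.i2, e.ext_src ?_ ?_⟩
      · rw [h00]; simp
      · have := congrArg (· ≫ e.i2) hr
        simpa using this
    · obtain ⟨v, hv⟩ := FS.retr hS hG hc _ h0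
      obtain ⟨r, hr⟩ := ih hc (e.i2 ≫ u ≫ (𝟙 c - v ≫ e.i1 ≫ u)) (fun T hT x hx => by
        have h2 : (x ≫ e.i2 - (x ≫ e.i2 ≫ u ≫ v) ≫ e.i1) ≫ u = 0 := by
          simpa using hx
        have := hu T hT _ h2
        simpa using congrArg (· ≫ e.p2) this)
      have hv' : e.i1 ≫ u ≫ v = 𝟙 G := by simpa using hv
      have hva : ∀ {T : C} (f : G ⟶ T), e.i1 ≫ u ≫ v ≫ f = f := fun f => by
        have := congrArg (· ≫ f) hv'
        simpa using this
      have hra : ∀ {T : C} (f : i1 ⟶ T), e.i2 ≫ u ≫ r ≫ f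
          - e.i2 ≫ u ≫ v ≫ e.i1 ≫ u ≫ r ≫ f = f := fun f => by
        have := congrArg (· ≫ f) hr
        simpa using this
      refine ⟨v ≫ e.i1 + (𝟙 c - v ≫ e.i1 ≫ u) ≫ r ≫ (e.i2 - e.i2 ≫ u ≫ v ≫ e.i1), e.ext_src ?_ ?_⟩
      · simp [hv', hva]
      · have h5 := hra (e.i2 - e.i2 ≫ u ≫ v ≫ e.i1)
        simp only [Preadditive.comp_add, Preadditive.comp_sub, Preadditive.sub_comp,
          Category.assoc, Category.id_comp, Category.comp_id] at h5 ⊢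
        have h6 := congrArg (fun t => t + e.i2 ≫ u ≫ v ≫ e.i1) h5
        simp only [sub_add_cancel] at h6
        refine Eq.trans ?_ h6; abel
end

section
variable [HasFiniteBiproducts C]

/-- split off the first summand -/
noncomputable def decFin {n : ℕ} (F : Fin (n + 1) → C) :
    Dec (F 0) (⨁ fun k : Fin n => F k.succ) (⨁ F) where
  i1 := biproduct.ι F 0
  i2 := biproduct.desc (fun k => biproduct.ι F k.succ)
  p1 := biproduct.π F 0
  p2 := biproduct.lift (fun k => biproduct.π F k.succ)
  i1p1 := by simp
  i2p2 := by
    apply biproduct.hom_ext'; intro j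
    apply biproduct.hom_ext; intro k
    by_cases h : j = k
    · subst h; simp
    · have : j.succ ≠ k.succ := fun h' => h (Fin.succ_injective _ h')
      simp [biproduct.ι_π_ne _ h, biproduct.ι_π_ne _ this]
  i1p2 := by
    apply biproduct.hom_ext; intro k
    simp [biproduct.ι_π_ne _ (Fin.succ_ne_zero k).symm]
  i2p1 := by
    apply biproduct.hom_ext'; intro k
    simp [biproduct.ι_π_ne _ (Fin.succ_ne_zero k)]
  total := by
    rw [biproduct.lift_desc, ← biproduct.total, Fin.sum_univ_succ]

lemma isZero_biproduct_fin0 (F : Fin 0 → C) : IsZero (⨁ F) := by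
  rw [IsZero.iff_id_eq_zero]
  apply biproduct.hom_ext; intro j; exact j.elim0

lemma FS.biproduct {D : C → Prop} {n : ℕ} (F : Fin n → C) (hF : ∀ i, D (F i)) : FS D (⨁ F) := by
  induction n with
  | zero => exact .zero (isZero_biproduct_fin0 F)
  | succ n ih => exact .cons (hF 0) (ih _ (fun i => hF i.succ)) (decFin F)

lemma FS.exists_biproduct {D : C → Prop} {X : C} (h : FS D X) :
    ∃ (n : ℕ) (F : Fin n → C), (∀ i, D (F i)) ∧ Nonempty (X ≅ ⨁ F) := by
  induction h with
  | zero h => exact ⟨0, fun i => i.elim0, fun i => i.elim0, ⟨h.iso (isZero_biproduct_fin0 _)⟩⟩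
  | @cons G X' X hG h d ih =>
    obtain ⟨n, F, hF, ⟨e⟩⟩ := ih
    exact ⟨n + 1, Fin.cons G F, fun i => by refine Fin.cases hG hF i,
      ⟨(d.iso2 e).uniq (decFin (Fin.cons G F))⟩⟩
end

end Part2

section Part3

variable {C : Type u} [Category.{v} C] [HasZeroObject C] [Preadditive C] [HasShift C ℤ]
  [∀ n : ℤ, (shiftFunctor C n).Additive] [Pretriangulated C]

lemma tri_unrot {V Y c : C} {a : V ⟶ Y} {b : Y ⟶ c⟦(1 : ℤ)⟧} {k : c⟦(1 : ℤ)⟧ ⟶ V⟦(1 : ℤ)⟧}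
    (H : Tri a b k) : ∃ (f : c ⟶ V) (h : Y ⟶ c⟦(1 : ℤ)⟧), Tri f a h := by
  have H2 := inv_rot_of_distTriang _ H
  exact ⟨_, _, Tri.iso1 H2 ((shiftEquiv C (1 : ℤ)).unitIso.app c)⟩

lemma Tri.shift1 {X Y Z : C} {f : X ⟶ Y} {g : Y ⟶ Z} {h : Z ⟶ X⟦(1 : ℤ)⟧} (H : Tri f g h) :
    ∃ (g' : Y⟦(1 : ℤ)⟧ ⟶ Z⟦(1 : ℤ)⟧) (h' : Z⟦(1 : ℤ)⟧ ⟶ (X⟦(1 : ℤ)⟧)⟦(1 : ℤ)⟧),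
      Tri (f⟦(1 : ℤ)⟧') g' h' := by
  have H3 := H.rot.rot.rot
  let e : Y⟦(1 : ℤ)⟧ ≅ Y⟦(1 : ℤ)⟧ := ⟨-𝟙 _, -𝟙 _, by simp, by simp⟩
  have := H3.iso2 e
  have q : (-f⟦(1 : ℤ)⟧') ≫ e.inv = f⟦(1 : ℤ)⟧' := by simp [e]
  rw [q] at this
  exact ⟨_, _, this⟩

lemma cone_uniq {X Y Z Z' : C} {f : X ⟶ Y} {g : Y ⟶ Z} {h : Z ⟶ X⟦(1 : ℤ)⟧}
    {g' : Y ⟶ Z'} {h' : Z' ⟶ X⟦(1 : ℤ)⟧} (H : Tri f g h) (H' : Tri f g' h') : Nonempty (Z ≅ Z') := by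
  obtain ⟨e, -, -⟩ := exists_iso_of_arrow_iso _ _ H H' (Iso.refl (Arrow.mk f))
  exact ⟨Triangle.π₃.mapIso e⟩

lemma tri_inj {X Y Z : C} {f : X ⟶ Y} {g : Y ⟶ Z} {h : Z ⟶ X⟦(1 : ℤ)⟧} (H : Tri f g h)
    {T : C} (hT : Perp (T⟦(1 : ℤ)⟧) Z) (x : T ⟶ X) (hx : x ≫ f = 0) : x = 0 := by
  obtain ⟨y, hy⟩ := H.lift1 (x⟦(1 : ℤ)⟧') (by rw [← Functor.map_comp, hx, Functor.map_zero])
  apply (shiftFunctor C (1 : ℤ)).map_injective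
  rw [hy, hT y, zero_comp, Functor.map_zero]

/-- Abstract properties of the shifted simple objects. -/
structure Cells (E : ℤ → ℤ → C → Prop) : Prop where
  iso : ∀ {m s : ℤ} {X Y : C}, (X ≅ Y) → E m s X → E m s Y
  shift : ∀ {m s : ℤ} {X : C} (a : ℤ), E m s X → E m (s + a) (X⟦a⟧)
  orth : ∀ {m s j r : ℤ} {X Y : C}, E m s X → E j r Y → ∀ f : X ⟶ Y,
    f = 0 ∨ (m = j ∧ s = r ∧ IsIso f) ∨ (1 ≤ r - s ∧ r - s ≤ m - j)

/-- strict order of positions -/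
abbrev before (j r m s : ℤ) : Prop := s < r ∨ (r = s ∧ j < m)
/-- nonstrict order of positions -/
abbrev leq (j r m s : ℤ) : Prop := s < r ∨ (r = s ∧ j ≤ m)

/-- sorted towers -/
inductive ST (E : ℤ → ℤ → C → Prop) (φ : ℤ → ℤ → Prop) : ℤ → ℤ → C → Prop
  | zero {m s : ℤ} {X : C} (h : IsZero X) : ST E φ m s X
  | cons {m0 s0 m s : ℤ} {c X X1 : C} {f : c ⟶ X} {g : X ⟶ X1} {h : X1 ⟶ c⟦(1 : ℤ)⟧}
      (hl : leq m0 s0 m s) (hφ : φ m s) (H : Tri f g h) (hc : FS (E m s) c)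
      (hX : ST E φ (m + 1) s X1) : ST E φ m0 s0 X

variable {E : ℤ → ℤ → C → Prop}

lemma Cells.schur (hE : Cells E) (m s : ℤ) (G G' : C) (h : E m s G) (h' : E m s G')
    (f : G ⟶ G') : f = 0 ∨ IsIso f := by
  rcases hE.orth h h' f with h | h | h
  · exact .inl h
  · exact .inr h.2.2
  · omega

lemma Cells.perp (hE : Cells E) {m s j r : ℤ} {X Y : C} (hX : E m s X) (hY : E j r Y)
    (h1 : ¬ (m = j ∧ s = r)) (h2 : ¬ (1 ≤ r - s ∧ r - s ≤ m - j)) : Perp X Y := fun f => by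
  rcases hE.orth hX hY f with h | h | h
  · exact h
  · exact absurd ⟨h.1, h.2.1⟩ h1
  · exact absurd h h2

lemma Cells.perpFS (hE : Cells E) {m s j r : ℤ} {X Y : C} (hX : FS (E m s) X) (hY : FS (E j r) Y)
    (h1 : ¬ (m = j ∧ s = r)) (h2 : ¬ (1 ≤ r - s ∧ r - s ≤ m - j)) : Perp X Y :=
  hX.perpL fun _ hG => hY.perpR fun _ hG' => hE.perp hG hG' h1 h2

lemma Cells.shiftFS (hE : Cells E) {m s : ℤ} {X : C} (a : ℤ) (hX : FS (E m s) X) :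
    FS (E m (s + a)) (X⟦a⟧) := hX.shift a fun _ h => hE.shift a h

section
variable {φ : ℤ → ℤ → Prop} {m s : ℤ} {X : C}

lemma ST.iso (h : ST E φ m s X) {Y : C} (e : X ≅ Y) : ST E φ m s Y := by
  cases h with
  | zero h => exact .zero (h.of_iso e.symm)
  | cons hl hφ H hc hX => exact .cons hl hφ (H.iso2 e.symm) hc hX

lemma ST.weaken (h : ST E φ m s X) {m0 s0 : ℤ} (hl : leq m0 s0 m s) : ST E φ m0 s0 X := by
  cases h with
  | zero h => exact .zero h
  | cons hl' hφ H hc hX => exact .cons (by omega) hφ H hc hX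

lemma ST.repos (h : ST E φ m s X) {m0 s0 : ℤ} (hl : ∀ m s, φ m s → leq m0 s0 m s) :
    ST E φ m0 s0 X := by
  cases h with
  | zero h => exact .zero h
  | cons hl' hφ H hc hX => exact .cons (hl _ _ hφ) hφ H hc hX

lemma ST.mono (h : ST E φ m s X) {ψ : ℤ → ℤ → Prop} (hl : ∀ j r, leq m s j r → φ j r → ψ j r) :
    ST E ψ m s X := by
  induction h with
  | zero h => exact .zero h
  | cons hl' hφ H hc hX ih => 
    exact .cons hl' (hl _ _ hl' hφ) H hc (ih fun j r h1 h2 => hl j r (by omega) h2)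

lemma ST.shift (hE : Cells E) (h : ST E φ m s X) {ψ : ℤ → ℤ → Prop} (a : ℤ)
    (hl : ∀ j r, φ j r → ψ j (r + a)) : ST E ψ m (s + a) (X⟦a⟧) := by
  induction h with
  | zero h => exact .zero ((shiftFunctor C a).map_isZero h)
  | cons hl' hφ H hc hX ih =>
    obtain ⟨f', g', h', H'⟩ := H.shift a
    exact .cons (by omega) (hl _ _ hφ) H' (hE.shiftFS a hc) ih

lemma ST.single (hc : FS (E m s) X) (h : φ m s) : ST E φ m s X :=
  .cons (by omega) h (tri_id_zero X (isZero_zero C)) hc (.zero (isZero_zero C))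

lemma ST.perp (hE : Cells E) (h : ST E φ m s X) {j r : ℤ} {T : C} (hT : FS (E j r) T)
    (hb : before j r m s) : Perp T X := by
  induction h with
  | zero h => exact perp_zeroR h
  | cons hl' hφ H hc hX ih =>
    exact Perp.extR H (hE.perpFS hT hc (by omega) (by omega)) (ih (by omega))

lemma ST.perp1 (hE : Cells E) (h : ST E φ m s X) {j r : ℤ} {T : C} (hT : FS (E j r) T)
    (hb : before j (r + 1) m s) : Perp (T⟦(1 : ℤ)⟧) X := h.perp hE (hE.shiftFS 1 hT) hb

lemma ST.restrict (hE : Cells E) {φ0 : ℤ → ℤ → Prop} (h : ST E φ0 m s X)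
    (hφ : ∀ m s j r, φ m s → r ≤ s → m + s < j + r → φ j r)
    (hX : ∀ j r, ¬ φ j r → ∀ T, E j r T → Perp T X) :
    ST E (fun m s => φ0 m s ∧ φ m s) m s X := by
  induction h with
  | zero h => exact .zero h
  | @cons m0 s0 m s c X X1 f g h hl hφ0 H hc hX1 ih =>
    by_cases hm : φ m s
    · refine .cons hl ⟨hφ0, hm⟩ H hc (ih fun j r hj T hT => ?_)
      by_cases hjr : before j r (m + 1) s
      · exact hX1.perp hE (.single hT) hjr
      · refine Perp.coneR H (hX j r hj T hT) (hE.perpFS (.single hT) (hE.shiftFS 1 hc) (by omega) ?_)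
        intro hh
        exact hj (hφ m s j r hm (by omega) (by omega))
    · have h0 : f = 0 := hc.perpL (hX m s hm) f
      have hz : IsZero c := by
        rw [IsZero.iff_id_eq_zero]
        exact tri_inj H (hX1.perp1 hE hc (by omega)) _ (by rw [h0, comp_zero])
      have := H.iso_of_zero1 hz
      have e : X ≅ X1 := asIso g
      exact ((ih fun j r hj T hT => (hX j r hj T hT).isoR e).iso e.symm).weaken (by omega)

lemma ST.raise (hE : Cells E) (h : ST E φ m s X) {m0 s0 : ℤ}
    (hX : ∀ j r, before j r m0 s0 → ∀ T, E j r T → Perp T X) : ST E φ m0 s0 X := by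
  have := h.restrict hE (φ := fun j r => leq m0 s0 j r) (by intros; omega)
    (fun j r hj => hX j r (by omega))
  exact (this.repos fun m s h => h.2).mono fun j r _ h => h.1

end

/-- existence of a sorted tower -/
def HasST (E : ℤ → ℤ → C → Prop) (X : C) : Prop := ∃ m s, ST E (fun _ _ => True) m s X

lemma HasST.iso {X Y : C} (h : HasST E X) (e : X ≅ Y) : HasST E Y :=
  let ⟨m, s, h⟩ := h; ⟨m, s, h.iso e⟩

lemma HasST.shift (hE : Cells E) {X : C} (h : HasST E X) (a : ℤ) : HasST E (X⟦a⟧) :=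
  let ⟨m, s, h⟩ := h; ⟨m, s + a, h.shift hE a fun _ _ _ => trivial⟩

lemma HasST.raise (hE : Cells E) {X : C} (h : HasST E X) {m0 s0 : ℤ}
    (hX : ∀ j r, before j r m0 s0 → ∀ T, E j r T → Perp T X) : ST E (fun _ _ => True) m0 s0 X :=
  let ⟨_, _, h⟩ := h; h.raise hE hX

theorem insert' (hE : Cells E) {m s : ℤ} {c : C} (hc : FS (E m s) c) {j r : ℤ} {Y : C}
    (hY : ST E (fun _ _ => True) j r Y) : ∀ {X : C} {f : c ⟶ X} {g : X ⟶ Y} {h : Y ⟶ c⟦(1 : ℤ)⟧},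
    Tri f g h → before m (s + 1) j r → HasST E X := by
  induction hY with
  | zero h0 =>
    intro X f g h H _
    have := H.iso_of_zero3 h0
    exact ⟨m, s, (ST.single hc trivial).iso (asIso f)⟩
  | @cons j0 r0 j r d Y Y1 fY gY hY hl _ HY hd hY1 ih =>
    intro X f g h H hb
    by_cases h1 : before m s j r
    · exact ⟨m, s, .cons (by omega) trivial H hc (.cons (m := j) (s := r) (by omega) trivial HY hd hY1)⟩
    have hl' : Perp d (c⟦(1 : ℤ)⟧) :=
      hE.perpFS hd (hE.shiftFS 1 hc) (by omega) (by omega)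
    obtain ⟨d', hd'⟩ := H.lift3 fY (hl' _)
    by_cases h2 : m = j ∧ s = r
    · obtain ⟨rfl, rfl⟩ := h2
      let e := Dec.mk' c d
      let w := e.p1 ≫ f + e.p2 ≫ d'
      obtain ⟨Z, z2, h2, HZ⟩ := exists_cone w
      have hYT : ST E (fun _ _ => True) m s Y :=
        .cons (by omega) trivial HY hd hY1
      have hp : Perp (c⟦(1 : ℤ)⟧) Z := by
        intro x
        obtain ⟨x', hx'⟩ := (shiftFunctor C (1 : ℤ)).map_surjective (x ≫ h2)
        have q1 : x' ≫ w = 0 := by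
          apply (shiftFunctor C (1 : ℤ)).map_injective
          rw [Functor.map_comp, hx', Category.assoc, HZ.z31, comp_zero, Functor.map_zero]
        have q2 : x' ≫ e.p2 = 0 := by
          refine tri_inj HY (hY1.perp1 hE hc (by omega)) _ ?_
          have := congrArg (· ≫ g) q1
          simpa [w, H.z12, ← hd'] using this
        have q3 : x' ≫ e.p1 = 0 := by
          refine tri_inj H (hYT.perp1 hE hc (by omega)) _ ?_
          rw [e.eq_tgt x', q2] at q1
          simpa [w] using q1
        have q4 : x' = 0 := by rw [e.eq_tgt x', q2, q3]; simp
        rw [q4, Functor.map_zero] at hx'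
        obtain ⟨y, rfl⟩ := HZ.lift3 x hx'.symm
        have : Perp (c⟦(1 : ℤ)⟧) X := Perp.extR H
          (hE.perpFS (hE.shiftFS 1 hc) hc (by omega) (by omega)) (hYT.perp1 hE hc (by omega))
        rw [this y, zero_comp]
      have hcomp : e.i1 ≫ w = f := by simp [w]
      obtain ⟨α, β, hα, -, -, -, HO⟩ := oct e.tri HZ (hcomp.symm ▸ H) hp
      have hα' : α = fY := by
        have := congrArg (e.i2 ≫ ·) hα
        simpa [w, ← hd'] using this
      subst hα'
      obtain ⟨i⟩ := cone_uniq HY HO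
      exact ⟨m, s, .cons (by omega) trivial HZ (hc.sum hd e) (hY1.iso i)⟩
    · obtain ⟨V, v1, v2, HV⟩ := exists_cone d'
      obtain ⟨α, β, -, -, -, -, HO⟩ := oct HV H.rot (hd' ▸ HY)
        ((hE.perpFS hd hc (by omega) (by omega)).shift 1)
      obtain ⟨f', h', HO'⟩ := tri_unrot HO
      have hV := (ih HO' (by omega)).raise hE (m0 := j + 1) (s0 := r) (fun j' r' hj T hT =>
        Perp.extR HO' (hE.perpFS (.single hT) hc (by omega) (by omega))
          (hY1.perp hE (.single hT) hj))
      exact ⟨j, r, .cons (by omega) trivial HV hd hV⟩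

theorem hasST_ext (hE : Cells E) {a b : ℤ} {X'' : C} (h'' : ST E (fun _ _ => True) a b X'') :
    ∀ {X' : C}, HasST E X' → ∀ {X : C} {f : X' ⟶ X} {g : X ⟶ X''} {δ : X'' ⟶ X'⟦(1 : ℤ)⟧},
    Tri f g δ → HasST E X := by
  induction h'' with
  | zero h0 =>
    intro X' hX' X f g δ H
    have := H.iso_of_zero3 h0
    exact hX'.iso (asIso f)
  | @cons j0 r0 j r c'' X'' X1'' f'' g'' δ'' hl'' _ H'' hc'' h1'' ihO =>
    rintro X' ⟨m0, s0, hX'⟩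
    have hXT'' : ST E (fun _ _ => True) j r X'' := .cons (by omega) trivial H'' hc'' h1''
    induction hX' with
    | zero h0 =>
      intro X f g δ H
      have := H.iso_of_zero1 h0
      exact ⟨j, r, hXT''.iso (asIso g).symm⟩
    | @cons m0 s0 m s c' X' X1' f' g' δ' hl' _ H' hc' h1' ihI =>
      intro X f g δ H
      have hXT' : ST E (fun _ _ => True) m s X' := .cons (by omega) trivial H' hc' h1'
      by_cases ha : before m (s + 1) j r
      · skip
        obtain ⟨Y, y1, y2, HY⟩ := exists_cone (f' ≫ f)
        obtain ⟨α, β, -, -, -, -, HO⟩ := oct H' H HY (hXT''.perp1 hE hc' ha)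
        have hY := (ihI HO).raise hE (m0 := m + 1) (s0 := s + 1) (fun j' r' hj T hT =>
          Perp.extR HO (h1'.perp hE (.single hT) (by omega)) (hXT''.perp hE (.single hT) (by omega)))
        exact insert' hE hc' hY HY (by omega)
      by_cases hb : before j r m (s + 1)
      · skip
        have hz : f'' ≫ δ = 0 :=
          (hXT'.shift hE 1 (ψ := fun _ _ => True) fun _ _ _ => trivial).perp hE hc'' hb _
        obtain ⟨l, hlg⟩ := H.lift3 f'' hz
        obtain ⟨V, v1, v2, HV⟩ := exists_cone l
        obtain ⟨α, β, -, -, -, -, HO⟩ := oct HV H.rot (hlg ▸ H'')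
          ((hXT'.perp hE hc'' (by omega)).shift 1)
        obtain ⟨f1, h1, HO'⟩ := tri_unrot HO
        have hV := (ihO ⟨m, s, hXT'⟩ HO').raise hE (m0 := j + 1) (s0 := r) (fun j' r' hj T hT =>
          Perp.extR HO' (hXT'.perp hE (.single hT) (by omega)) (h1''.perp hE (.single hT) hj))
        exact ⟨j, r, .cons (by omega) trivial HV hc'' hV⟩
      obtain ⟨rfl, rfl⟩ : j = m ∧ r = s + 1 := by omega
      obtain ⟨k, i, d, hk, hi, hd1, hd2⟩ := FS.split (hE.schur _ _) hc'' (f'' ≫ δ)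
      obtain ⟨U, uz, u3, HU⟩ := exists_cone (d.i1 ≫ f'')
      obtain ⟨αA, βA, hA, -, -, -, HA⟩ := oct d.tri H'' HU (h1''.perp1 hE hk (by omega))
      obtain ⟨l, hlg⟩ := H.lift3 (d.i1 ≫ f'') (by simpa using hd1)
      obtain ⟨V, v1, v2, HV⟩ := exists_cone l
      obtain ⟨αB, βB, -, -, hB, -, HB⟩ := oct HV H.rot (hlg ▸ HU)
        ((hXT'.perp hE hk (by omega)).shift 1)
      obtain ⟨fB, hB', HB'⟩ := tri_unrot HB
      have hAB : αA ≫ βB = d.i2 ≫ f'' ≫ δ := by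
        have := congrArg (fun t => d.i2 ≫ t ≫ βB) hA
        simpa [hB] using this
      have hinj : ∀ T, E j (s + 1) T → ∀ x : T ⟶ i, x ≫ αA ≫ βB = 0 → x = 0 := by
        rw [hAB]; exact hd2
      have hTV : ∀ T, E j (s + 1) T → Perp T V := by
        intro T hT x
        obtain ⟨y, hy⟩ := HA.lift2 (x ≫ αB) (h1''.perp hE (.single hT) (by omega) _)
        have hy0 : y = 0 := hinj T hT y (by
          rw [← Category.assoc, ← hy, Category.assoc, HB.z12, comp_zero])
        rw [hy0, zero_comp] at hy
        obtain ⟨z, rfl⟩ := HB'.lift2 x hy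
        rw [hXT'.perp hE (.single hT) (by omega) z, zero_comp]
      obtain ⟨W', w1, w2, HW⟩ := exists_cone (αA ≫ βB)
      obtain ⟨α1, β1, -, -, -, -, HO⟩ := oct HA HB.rot HW ((hi.perpL hTV).shift 1)
      obtain ⟨W0, a1, a2, a3, HW0, ⟨eW⟩⟩ := tri_unshift HO
      obtain ⟨t, ht⟩ := H'.lift2s (αA ≫ βB)
        ((h1'.shift hE 1 (ψ := fun _ _ => True) fun _ _ _ => trivial).perp hE hi (by omega) _)
      have hc1 := hE.shiftFS 1 hc'
      obtain ⟨ρ, hρ⟩ := FS.injSplit (hE.schur _ _) hi hc1 t (fun T hT x hx => hinj T hT x (by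
        rw [ht, ← Category.assoc, hx, zero_comp]))
      obtain ⟨d', t1, t2, Ht⟩ := exists_cone t
      obtain ⟨σ, hσ⟩ := tri_split_mono Ht ρ hρ
      have hd' : FS (E j (s + 1)) d' :=
        hc1.retract (fun G hG f => hE.schur _ _ G G hG hG f) σ t1 hσ
      obtain ⟨g1, g2, H1⟩ := H'.shift1
      have h1s := h1'.shift hE 1 (ψ := fun _ _ => True) fun _ _ _ => trivial
      obtain ⟨α2, β2, -, -, -, -, HO2⟩ := oct Ht H1 (ht ▸ HW) (h1s.perp1 hE hi (by omega))
      have hW' : HasST E W' := ⟨j, s + 1, .cons (by omega) trivial HO2 hd' h1s⟩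
      have hW0 : HasST E W0 := ((hW'.iso eW.symm).shift hE (-1)).iso
        ((shiftEquiv C (1 : ℤ)).unitIso.app W0).symm
      have hV := (ihO hW0 HW0).raise hE (m0 := j + 1) (s0 := s + 1) (fun j' r' hj T hT => by
        by_cases hh : j' = j ∧ r' = s + 1
        · obtain ⟨rfl, rfl⟩ := hh
          exact hTV T hT
        · refine Perp.extR HB' (hXT'.perp hE (.single hT) (by omega)) (Perp.extR HA ?_
            (h1''.perp hE (.single hT) (by omega)))
          exact hE.perpFS (.single hT) hi (by omega) (by omega))
      exact ⟨j, s + 1, .cons (by omega) trivial HV hk hV⟩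

end Part3

section Part4

variable {C : Type u} [Category.{v} C] [HasZeroObject C] [Preadditive C] [HasShift C ℤ]
  [∀ n : ℤ, (shiftFunctor C n).Additive] [Pretriangulated C]

/-- left orthogonal to the cells in `φ` -/
def LO (E : ℤ → ℤ → C → Prop) (φ : ℤ → ℤ → Prop) (X : C) : Prop :=
  ∀ m s, φ m s → ∀ G, E m s G → Perp X G
/-- right orthogonal to the cells in `φ` -/
def RO (E : ℤ → ℤ → C → Prop) (φ : ℤ → ℤ → Prop) (X : C) : Prop :=
  ∀ m s, φ m s → ∀ G, E m s G → Perp G X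

variable {E : ℤ → ℤ → C → Prop} {φ ψ : ℤ → ℤ → Prop} {X Y Z : C}

lemma LO.mono (h : LO E φ X) (hl : ∀ m s, ψ m s → φ m s) : LO E ψ X :=
  fun m s hm => h m s (hl m s hm)
lemma RO.mono (h : RO E φ X) (hl : ∀ m s, ψ m s → φ m s) : RO E ψ X :=
  fun m s hm => h m s (hl m s hm)
lemma LO.iso (h : LO E φ X) (e : X ≅ Y) : LO E φ Y := fun m s hm G hG => (h m s hm G hG).isoL e
lemma RO.iso (h : RO E φ X) (e : X ≅ Y) : RO E φ Y := fun m s hm G hG => (h m s hm G hG).isoR e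
lemma LO.ret (h : LO E φ Y) (s : X ⟶ Y) (r : Y ⟶ X) (hs : s ≫ r = 𝟙 X) : LO E φ X :=
  fun m k hm G hG => (h m k hm G hG).retL s r hs
lemma RO.ret (h : RO E φ Y) (s : X ⟶ Y) (r : Y ⟶ X) (hs : s ≫ r = 𝟙 X) : RO E φ X :=
  fun m k hm G hG => (h m k hm G hG).retR s r hs
lemma LO.zero (h : IsZero X) : LO E φ X := fun _ _ _ _ _ => perp_zeroL h
lemma RO.zero (h : IsZero X) : RO E φ X := fun _ _ _ _ _ => perp_zeroR h
lemma LO.ext {f : X ⟶ Y} {g : Y ⟶ Z} {h : Z ⟶ X⟦(1 : ℤ)⟧} (H : Tri f g h) (hX : LO E φ X)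
    (hZ : LO E φ Z) : LO E φ Y :=
  fun m s hm G hG => Perp.extL H (hX m s hm G hG) (hZ m s hm G hG)
lemma RO.ext {f : X ⟶ Y} {g : Y ⟶ Z} {h : Z ⟶ X⟦(1 : ℤ)⟧} (H : Tri f g h) (hX : RO E φ X)
    (hZ : RO E φ Z) : RO E φ Y :=
  fun m s hm G hG => Perp.extR H (hX m s hm G hG) (hZ m s hm G hG)

lemma LO.shift (hE : Cells E) (h : LO E φ X) (a : ℤ) (hl : ∀ m s, ψ m s → φ m (s - a)) :
    LO E ψ (X⟦a⟧) := fun m s hm G hG => by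
  have h1 := (h m (s - a) (hl m s hm) (G⟦-a⟧) (by simpa [sub_eq_add_neg] using hE.shift (-a) hG)).shift a
  exact h1.isoR ((shiftEquiv C a).counitIso.app G)
lemma RO.shift (hE : Cells E) (h : RO E φ X) (a : ℤ) (hl : ∀ m s, ψ m s → φ m (s - a)) :
    RO E ψ (X⟦a⟧) := fun m s hm G hG => by
  have h1 := (h m (s - a) (hl m s hm) (G⟦-a⟧) (by simpa [sub_eq_add_neg] using hE.shift (-a) hG)).shift a
  exact h1.isoL ((shiftEquiv C a).counitIso.app G)

lemma FS.lo (hE : Cells E) {m s : ℤ} (hX : FS (E m s) X)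
    (h : ∀ j r, φ j r → ¬ (m = j ∧ s = r) ∧ ¬ (1 ≤ r - s ∧ r - s ≤ m - j)) : LO E φ X :=
  fun j r hj _ hG => hE.perpFS hX (.single hG) (h j r hj).1 (h j r hj).2
lemma FS.ro (hE : Cells E) {m s : ℤ} (hX : FS (E m s) X)
    (h : ∀ j r, φ j r → ¬ (m = j ∧ s = r) ∧ ¬ (1 ≤ s - r ∧ s - r ≤ j - m)) : RO E φ X :=
  fun j r hj _ hG => hE.perpFS (.single hG) hX (fun hh => (h j r hj).1 ⟨hh.1.symm, hh.2.symm⟩) (h j r hj).2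
lemma ST.lo (hE : Cells E) {m s : ℤ} (hX : ST E ψ m s X)
    (h : ∀ m s j r, ψ m s → φ j r → ¬ (m = j ∧ s = r) ∧ ¬ (1 ≤ r - s ∧ r - s ≤ m - j)) :
    LO E φ X := by
  induction hX with
  | zero h => exact LO.zero h
  | cons hl hφ H hc hX ih => exact LO.ext H (hc.lo hE fun j r hj => h _ _ j r hφ hj) ih
lemma ST.ro (hE : Cells E) {m s : ℤ} (hX : ST E ψ m s X)
    (h : ∀ m s j r, ψ m s → φ j r → ¬ (m = j ∧ s = r) ∧ ¬ (1 ≤ s - r ∧ s - r ≤ j - m)) :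
    RO E φ X := by
  induction hX with
  | zero h => exact RO.zero h
  | cons hl hφ H hc hX ih => exact RO.ext H (hc.ro hE fun j r hj => h _ _ j r hφ hj) ih

lemma LO.perp_st (hX : LO E φ X) {m s : ℤ} (hY : ST E φ m s Y) : Perp X Y := by
  induction hY with
  | zero h => exact perp_zeroR h
  | cons hl hφ H hc _ ih => exact Perp.extR H (hc.perpR (hX _ _ hφ)) ih

/-- weights at most `n` -/
def WLE (E : ℤ → ℤ → C → Prop) (n : ℤ) (X : C) : Prop := LO E (fun m s => n < m + s) X
/-- weights at least `n` -/
def WGE (E : ℤ → ℤ → C → Prop) (n : ℤ) (X : C) : Prop := RO E (fun m s => m + s < n) X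
/-- degrees at most `n` -/
def TLE (E : ℤ → ℤ → C → Prop) (n : ℤ) (X : C) : Prop := LO E (fun _ s => n < -s) X
/-- degrees at least `n` -/
def TGE (E : ℤ → ℤ → C → Prop) (n : ℤ) (X : C) : Prop := RO E (fun _ s => -s < n) X

lemma wge_st (hE : Cells E) (hX : HasST E X) {n : ℤ} (h : WGE E n X) :
    ∃ m s, ST E (fun m s => n ≤ m + s) m s X := by
  obtain ⟨m, s, hX⟩ := hX
  exact ⟨m, s, (hX.restrict hE (φ := fun m s => n ≤ m + s) (by intros; omega)
    (fun j r hj => h j r (by omega))).mono fun _ _ _ h => h.2⟩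
lemma tge_st (hE : Cells E) (hX : HasST E X) {n : ℤ} (h : TGE E n X) :
    ∃ m s, ST E (fun _ s => n ≤ -s) m s X := by
  obtain ⟨m, s, hX⟩ := hX
  exact ⟨m, s, (hX.restrict hE (φ := fun m s => n ≤ -s) (by intros; omega)
    (fun j r hj => h j r (by omega))).mono fun _ _ _ h => h.2⟩

lemma w_orth (hE : Cells E) (hY : HasST E Y) {n : ℤ} (h : WLE E n X) (h' : WGE E (n + 1) Y) :
    Perp X Y := by
  obtain ⟨m, s, hs⟩ := wge_st hE hY h'
  exact LO.perp_st (LO.mono h fun _ _ _ => by omega) hs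
lemma t_orth (hE : Cells E) (hY : HasST E Y) {n : ℤ} (h : TLE E n X) (h' : TGE E (n + 1) Y) :
    Perp X Y := by
  obtain ⟨m, s, hs⟩ := tge_st hE hY h'
  exact LO.perp_st (LO.mono h fun _ _ _ => by omega) hs

lemma bounded (hE : Cells E) (hX : HasST E X) : (∃ n, WLE E n X) ∧ (∃ n, WGE E n X) ∧
    (∃ n, TLE E n X) ∧ (∃ n, TGE E n X) := by
  obtain ⟨m, s, hX⟩ := hX
  induction hX with
  | zero h => exact ⟨⟨0, LO.zero h⟩, ⟨0, RO.zero h⟩, ⟨0, LO.zero h⟩, ⟨0, RO.zero h⟩⟩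
  | @cons m0 s0 m s c X X1 f g h hl hφ H hc hX ih =>
    obtain ⟨⟨n1, h1⟩, ⟨n2, h2⟩, ⟨n3, h3⟩, ⟨n4, h4⟩⟩ := ih
    refine ⟨⟨max n1 (m + s), LO.ext H (hc.lo hE fun j r hj => ?_) (h1.mono fun _ _ _ => ?_)⟩,
      ⟨min n2 (m + s), RO.ext H (hc.ro hE fun j r hj => ?_) (h2.mono fun _ _ _ => ?_)⟩,
      ⟨max n3 (-s), LO.ext H (hc.lo hE fun j r hj => ?_) (h3.mono fun _ _ _ => ?_)⟩,
      ⟨min n4 (-s), RO.ext H (hc.ro hE fun j r hj => ?_) (h4.mono fun _ _ _ => ?_)⟩⟩ <;> omega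

/-- technical: cohomological behaviour of `f` towards `Z` -/
def SurjInj {X X' : C} (f : X ⟶ X') (Z : C) : Prop :=
  (∀ u : X ⟶ Z, ∃ v, f ≫ v = u) ∧ (∀ v : X' ⟶ Z⟦(1 : ℤ)⟧, f ≫ v = 0 → v = 0)

lemma surjInj_id (X Z : C) : SurjInj (𝟙 X) Z := ⟨fun u => ⟨u, by simp⟩, fun v hv => by simpa using hv⟩

lemma SurjInj.comp {X X' X'' : C} {f : X ⟶ X'} {g : X' ⟶ X''} (hf : SurjInj f Z)
    (hg : SurjInj g Z) : SurjInj (f ≫ g) Z := by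
  refine ⟨fun u => ?_, fun v hv => hg.2 v (hf.2 _ (by simpa using hv))⟩
  obtain ⟨v, rfl⟩ := hf.1 u
  obtain ⟨w, rfl⟩ := hg.1 v
  exact ⟨w, by simp⟩

lemma surjInj_step {c X X1 : C} {f : c ⟶ X} {g : X ⟶ X1} {h : X1 ⟶ c⟦(1 : ℤ)⟧} (H : Tri f g h)
    (hc : Perp c Z) : SurjInj g Z := by
  refine ⟨fun u => ?_, fun v hv => ?_⟩
  · obtain ⟨v, hv⟩ := H.desc2 u (hc _)
    exact ⟨v, hv.symm⟩
  · obtain ⟨y, rfl⟩ := H.desc3 v hv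
    rw [hc.shift 1 y, comp_zero]

lemma SurjInj.fiber {W X X' : C} {f : W ⟶ X} {g : X ⟶ X'} {h : X' ⟶ W⟦(1 : ℤ)⟧} (H : Tri f g h)
    (hg : SurjInj g Z) : Perp W Z := by
  intro u
  have h1 : h ≫ u⟦(1 : ℤ)⟧' = 0 := hg.2 _ (by rw [← Category.assoc, H.z23, zero_comp])
  obtain ⟨y, hy⟩ := H.desc1 _ h1
  obtain ⟨y', rfl⟩ := (shiftFunctor C (1 : ℤ)).map_surjective y
  rw [← Functor.map_comp] at hy
  have := (shiftFunctor C (1 : ℤ)).map_injective hy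
  obtain ⟨v, rfl⟩ := hg.1 y'
  rw [this, ← Category.assoc, H.z12, zero_comp]

/-- cells of weight `n` -/
def WC (E : ℤ → ℤ → C → Prop) (n : ℤ) (X : C) : Prop := ∃ m s, m + s = n ∧ E m s X

lemma FS.wle (hE : Cells E) {n : ℤ} {c : C} (h : FS (WC E n) c) : WLE E n c :=
  fun m s hm G hG => h.perpL fun T ⟨j, r, hj, hT⟩ => hE.perp hT hG (by omega) (by omega)
lemma FS.wge (hE : Cells E) {n : ℤ} {c : C} (h : FS (WC E n) c) : WGE E n c :=
  fun m s hm G hG => h.perpR fun T ⟨j, r, hj, hT⟩ => hE.perp hG hT (by omega) (by omega)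

lemma cover (hE : Cells E) {n : ℤ} {m s : ℤ} (hX : ST E (fun m s => n ≤ m + s) m s X) :
    ∃ (c : C) (u : c ⟶ X), FS (WC E n) c ∧ ∀ T, WC E n T → ∀ x : T ⟶ X, ∃ y, x = y ≫ u := by
  induction hX with
  | @zero m s X h => exact ⟨X, 𝟙 X, .zero h, fun T _ x => ⟨x, by simp⟩⟩
  | @cons m0 s0 m s d X X1 f g h hl hφ H hd hX ih =>
    obtain ⟨c1, u1, hc1, hu1⟩ := ih
    obtain ⟨u, hu⟩ := H.lift3 u1 (hc1.perpL (fun T ⟨j, r, hj, hT⟩ => 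
      hE.perpFS (.single hT) (hE.shiftFS 1 hd) (by omega) (by omega)) _)
    have key : ∀ T, WC E n T → ∀ x : T ⟶ X, ∃ y z, x = y ≫ u + z ≫ f := by
      intro T hT x
      obtain ⟨y, hy⟩ := hu1 T hT (x ≫ g)
      obtain ⟨z, hz⟩ := H.lift2 (x - y ≫ u) (by
        rw [Preadditive.sub_comp, Category.assoc, ← hu, ← hy, sub_self])
      exact ⟨y, z, by rw [← hz]; abel⟩
    by_cases hn : m + s = n
    · let e := Dec.mk' d c1
      refine ⟨_, e.p1 ≫ f + e.p2 ≫ u, FS.sum (hd.mono fun G hG => ⟨m, s, hn, hG⟩) hc1 e, ?_⟩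
      intro T hT x
      obtain ⟨y, z, rfl⟩ := key T hT x
      exact ⟨y ≫ e.i2 + z ≫ e.i1, by simp [add_comm]⟩
    · refine ⟨c1, u, hc1, fun T hT x => ?_⟩
      obtain ⟨y, z, rfl⟩ := key T hT x
      obtain ⟨j, r, hj, hT⟩ := hT
      refine ⟨y, ?_⟩
      have hφ' : n ≤ m + s := hφ
      rw [hE.perpFS (.single hT) hd (by omega) (by omega) z, zero_comp, add_zero]

lemma cover_step (hE : Cells E) (hX : HasST E X) {n : ℤ} (h : WGE E n X) :
    ∃ (c X' : C) (u : c ⟶ X) (g : X ⟶ X') (k : X' ⟶ c⟦(1 : ℤ)⟧), Tri u g k ∧ FS (WC E n) c ∧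
      WGE E (n + 1) X' := by
  obtain ⟨m, s, hs⟩ := wge_st hE hX h
  obtain ⟨c, u, hc, hu⟩ := cover hE hs
  obtain ⟨X', g, k, H⟩ := exists_cone u
  refine ⟨c, X', u, g, k, H, hc, fun j r hj T hT x => ?_⟩
  have h1 : WGE E (n + 1) (c⟦(1 : ℤ)⟧) := RO.shift hE (hc.wge hE) 1 (by intros; omega)
  obtain ⟨y, rfl⟩ := H.lift3 x (h1 j r hj T hT _)
  by_cases hn : j + r = n
  · obtain ⟨z, rfl⟩ := hu T ⟨j, r, hn, hT⟩ y
    rw [Category.assoc, H.z12, comp_zero]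
  · rw [h j r (by omega) T hT y, zero_comp]

lemma w_trunc (hE : Cells E) (hall : ∀ X, HasST E X) (N : ℤ) (k : ℕ) : ∀ {X : C},
    WGE E (N + 1 - k) X → ∃ (X' : C) (f : X ⟶ X'), WGE E (N + 1) X' ∧
      ∀ m s, N < m + s → ∀ Z, E m s Z → SurjInj f Z := by
  induction k with
  | zero =>
    intro X hX
    exact ⟨X, 𝟙 X, by simpa using hX, fun m s _ Z _ => surjInj_id X Z⟩
  | succ k ih =>
    intro X hX
    obtain ⟨c, X1, u, g, k', H, hc, h1⟩ := cover_step hE (hall X) hX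
    obtain ⟨X', f, hX', hf⟩ := ih (X := X1) (by
      refine RO.mono h1 fun m s hm => ?_
      push_cast at *; omega)
    refine ⟨X', g ≫ f, hX', fun m s hm Z hZ => SurjInj.comp (surjInj_step H ?_) (hf m s hm Z hZ)⟩
    exact hc.wle hE m s (by push_cast at *; omega) Z hZ

lemma w_decomp (hE : Cells E) (hall : ∀ X, HasST E X) (N : ℤ) (X : C) :
    ∃ (B A : C) (f : B ⟶ X) (g : X ⟶ A) (h : A ⟶ B⟦(1 : ℤ)⟧),
      WLE E N B ∧ WGE E (N + 1) A ∧ Tri f g h := by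
  obtain ⟨n, hn⟩ := (bounded hE (hall X)).2.1
  obtain ⟨A, g, hA, hg⟩ := w_trunc hE hall N (N + 1 - n).toNat (X := X)
    (RO.mono hn fun m s hm => by omega)
  obtain ⟨B, f, h, H⟩ := exists_fiber g
  exact ⟨B, A, f, g, h, fun m s hm Z hZ => (hg m s hm Z hZ).fiber H, hA, H⟩

lemma w_heart (hE : Cells E) (hall : ∀ X, HasST E X) {n : ℤ} (h : WLE E n X) (h' : WGE E n X) :
    FS (WC E n) X := by
  obtain ⟨c, X1, u, g, k', H, hc, h1⟩ := cover_step hE (hall X) h'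
  obtain ⟨y, hy⟩ := H.lift2 (𝟙 X) (w_orth hE (hall X1) h h1 _)
  exact hc.retract (fun G ⟨m, s, _, hG⟩ f => hE.schur m s G G hG hG f) y u hy.symm

lemma ST.split (hψ : ∀ j r m s, before j r m s → ψ m s → ψ j r) {m s : ℤ} (hX : ST E φ m s X) :
    ∃ (X' : C) (f : X ⟶ X'), (∃ j r, ST E (fun m s => φ m s ∧ ¬ ψ m s) j r X') ∧
      ∀ Z, (∀ m s, φ m s → ψ m s → ∀ G, E m s G → Perp G Z) → SurjInj f Z := by
  induction hX with
  | @zero m s X h => exact ⟨X, 𝟙 X, ⟨m, s, .zero h⟩, fun Z _ => surjInj_id X Z⟩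
  | @cons m0 s0 m s d X X1 f g h hl hφ H hd hX ih =>
    by_cases hm : ψ m s
    · obtain ⟨X', f', h1, h2⟩ := ih
      exact ⟨X', g ≫ f', h1, fun Z hZ =>
        SurjInj.comp (surjInj_step H (hd.perpL (hZ m s hφ hm))) (h2 Z hZ)⟩
    · have hXT : ST E φ m s X := .cons (by omega) hφ H hd hX
      refine ⟨X, 𝟙 X, ⟨m, s, hXT.mono fun j r hl hj => ⟨hj, fun hh => hm ?_⟩⟩,
        fun Z _ => surjInj_id X Z⟩
      by_cases he : m = j ∧ s = r
      · obtain ⟨rfl, rfl⟩ := he; exact hh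
      · exact hψ m s j r (by omega) hh

lemma t_decomp (hE : Cells E) (hX : HasST E X) :
    ∃ (B A : C) (f : B ⟶ X) (g : X ⟶ A) (h : A ⟶ B⟦(1 : ℤ)⟧),
      TLE E 0 B ∧ TGE E 1 A ∧ Tri f g h := by
  obtain ⟨m, s, hX⟩ := hX
  obtain ⟨A, g, ⟨j, r, hA⟩, hg⟩ := hX.split (ψ := fun _ s => 0 ≤ s) (by intros; omega)
  obtain ⟨B, f, h, H⟩ := exists_fiber g
  refine ⟨B, A, f, g, h, fun m s hm Z hZ => (hg Z fun m' s' _ hs' G hG => ?_).fiber H, ?_, H⟩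
  · exact hE.perp hG hZ (by omega) (by omega)
  · exact hA.ro hE fun m s j r h1 h2 => by have := h1.2; omega

lemma heart_st (hE : Cells E) (hX : HasST E X) (h : TLE E 0 X) (h' : TGE E 0 X) :
    ∃ m s, ST E (fun _ s => s = 0) m s X := by
  obtain ⟨m, s, hs⟩ := tge_st hE hX h'
  refine ⟨m, s, ?_⟩
  clear h' hX
  induction hs with
  | zero h0 => exact .zero h0
  | @cons m0 s0 m s d X X1 f g k hl hφ H hd hX ih =>
    by_cases hs0 : s = 0
    · subst hs0
      refine .cons hl rfl H hd (ih fun j r hj Z hZ => ?_)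
      exact Perp.coneL H (h j r hj Z hZ)
        (hE.perpFS (hE.shiftFS 1 hd) (.single hZ) (by omega) (by omega))
    · have hφ' : 0 ≤ -s := hφ
      have hXT : ST E (fun _ s => 0 ≤ -s) m s X := .cons (by omega) hφ H hd hX
      have h1 : ST E (fun _ s => 0 < -s) m s X := hXT.mono fun j r hl _ => by omega
      refine .zero ((IsZero.iff_id_eq_zero X).2 (LO.perp_st h h1 _))

lemma st_heart (hE : Cells E) {m s : ℤ} (h : ST E (fun _ s => s = 0) m s X) :
    TLE E 0 X ∧ TGE E 0 X :=
  ⟨h.lo hE fun _ _ _ _ h1 h2 => by omega, h.ro hE fun _ _ _ _ h1 h2 => by omega⟩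

lemma nice (hE : Cells E) {m s : ℤ} (h : ST E (fun _ s => s = 0) m s X) (N : ℤ) :
    ∃ (B A : C) (f : B ⟶ X) (g : X ⟶ A) (h : A ⟶ B⟦(1 : ℤ)⟧), Tri f g h ∧
      WLE E N B ∧ WGE E (N + 1) A ∧ (TLE E 0 B ∧ TGE E 0 B) ∧ (TLE E 0 A ∧ TGE E 0 A) := by
  have hX := st_heart hE h
  obtain ⟨A, g, ⟨j, r, hA⟩, hg⟩ := h.split (ψ := fun m s => leq m s N 0) (by intros; omega)
  obtain ⟨B, f, k, H⟩ := exists_fiber g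
  have hA' : TLE E 0 A ∧ TGE E 0 A := st_heart hE (hA.mono fun _ _ _ h => h.1)
  refine ⟨B, A, f, g, k, H, ?_, ?_, ⟨?_, ?_⟩, hA'⟩
  · exact fun m s hm Z hZ => (hg Z fun m' s' _ hs' G hG =>
      hE.perp hG hZ (by omega) (by omega)).fiber H
  · exact hA.ro hE fun m s j r h1 h2 => by have := h1.1; have := h1.2; omega
  · exact fun m s hm Z hZ => (hg Z fun m' s' _ hs' G hG =>
      hE.perp hG hZ (by omega) (by omega)).fiber H
  · intro m s hm T hT x
    refine tri_inj H ?_ x (hX.2 m s hm T hT _)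
    exact hA'.2 m (s + 1) (by omega) _ (hE.shift 1 hT)

end Part4

section Part5

variable {C : Type u} [Category.{v} C] [HasZeroObject C] [Preadditive C] [HasShift C ℤ]
  [∀ n : ℤ, (shiftFunctor C n).Additive] [Pretriangulated C]

/-- the cells: shifts of simple objects -/
def cellsOf (S : ℤ → Set C) (m s : ℤ) (X : C) : Prop := ∃ G ∈ S m, Nonempty (X ≅ G⟦s⟧)

lemma cellsOf_cells (S : ℤ → Set C)
    (hS : ∀ m, ∀ X ∈ S m, ∀ Y ∈ S m, ∀ f : X ⟶ Y, f = 0 ∨ IsIso f)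
    (horth : ∀ m j s : ℤ, (s < 0 ∨ s > m - j ∨ (s = 0 ∧ m > j)) →
      ∀ X ∈ S m, ∀ Y ∈ S j, ∀ f : X ⟶ (Y⟦s⟧), f = 0) : Cells (cellsOf S) where
  iso := fun e ⟨G, hG, ⟨e'⟩⟩ => ⟨G, hG, ⟨e.symm ≪≫ e'⟩⟩
  shift := fun {m s X} a ⟨G, hG, ⟨e'⟩⟩ => ⟨G, hG,
    ⟨(shiftFunctor C a).mapIso e' ≪≫ ((shiftFunctorAdd C s a).app G).symm⟩⟩
  orth := by
    rintro m s j r X Y ⟨G, hG, ⟨e⟩⟩ ⟨G', hG', ⟨e'⟩⟩ f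
    by_cases h : 1 ≤ r - s ∧ r - s ≤ m - j
    · exact .inr (.inr h)
    by_cases h2 : m = j ∧ s = r
    · obtain ⟨rfl, rfl⟩ := h2
      obtain ⟨g, hg⟩ := (shiftFunctor C s).map_surjective (e.inv ≫ f ≫ e'.hom)
      have hf : f = e.hom ≫ g⟦s⟧' ≫ e'.inv := by simp [hg]
      rcases hS m G hG G' hG' g with h0 | h0
      · left; simp [hf, h0]
      · right; left; refine ⟨rfl, rfl, ?_⟩; rw [hf]; infer_instance
    · left
      have hp : Perp G (G'⟦r - s⟧) := horth m j (r - s) (by omega) G hG G' hG'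
      exact ((hp.shift s).isoL e.symm).isoR
        (((shiftFunctorAdd' C (r - s) s r (by omega)).app G').symm ≪≫ e'.symm) f

variable {E : ℤ → ℤ → C → Prop}

lemma LO.ofBicone {φ : ℤ → ℤ → Prop} {X Y : C} (b : BinaryBicone X Y) (hb : b.IsBilimit)
    (hX : LO E φ X) (hY : LO E φ Y) : LO E φ b.pt := fun m s hm G hG f => by
  refine BinaryCofan.IsColimit.hom_ext hb.isColimit ?_ ?_
  · exact (hX m s hm G hG _).trans (hX m s hm G hG _).symm
  · exact (hY m s hm G hG _).trans (hY m s hm G hG _).symm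

lemma RO.ofBicone {φ : ℤ → ℤ → Prop} {X Y : C} (b : BinaryBicone X Y) (hb : b.IsBilimit)
    (hX : RO E φ X) (hY : RO E φ Y) : RO E φ b.pt := fun m s hm G hG f => by
  refine BinaryFan.IsLimit.hom_ext hb.isLimit ?_ ?_
  · exact (hX m s hm G hG _).trans (hX m s hm G hG _).symm
  · exact (hY m s hm G hG _).trans (hY m s hm G hG _).symm

/-- the t-structure -/
def tOf (hE : Cells E) (hall : ∀ X, HasST E X) : TStructure C where
  le n X := TLE E n X
  ge n X := TGE E n X
  le_isClosedUnderIsomorphisms n := ⟨fun e h => LO.iso h e⟩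
  ge_isClosedUnderIsomorphisms n := ⟨fun e h => RO.iso h e⟩
  le_shift n a n' h X hX := LO.shift hE hX a (by intros; omega)
  ge_shift n a n' h X hX := RO.shift hE hX a (by intros; omega)
  zero' := fun {X Y} f hX hY => t_orth hE (hall Y) (n := 0) hX hY f
  le_zero_le := fun X hX => LO.mono hX (by intros; omega)
  ge_one_le := fun X hX => RO.mono hX (by intros; omega)
  exists_triangle_zero_one X := by
    obtain ⟨B, A, f, g, h, hB, hA, H⟩ := t_decomp hE (hall X)
    exact ⟨B, A, hB, hA, f, g, h, H⟩

lemma wStr (hE : Cells E) (hall : ∀ X, HasST E X) :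
    IsWeightStructure C {X | WLE E 0 X} {X | WGE E 0 X} where
  retract_le := fun X Y s r h hY => LO.ret hY s r h
  retract_ge := fun X Y s r h hY => RO.ret hY s r h
  zero_le := fun X h => LO.zero h
  zero_ge := fun X h => RO.zero h
  sum_le := fun X Y b hb hX hY => LO.ofBicone b hb hX hY
  sum_ge := fun X Y b hb hX hY => RO.ofBicone b hb hX hY
  shift_le := fun X hX => LO.shift hE hX _ (by intros; omega)
  shift_ge := fun X hX => RO.shift hE hX _ (by intros; omega)
  orthogonal := fun X Y hX hY f =>
    w_orth hE (hall _) (n := 0) hX (RO.shift hE hY 1 (by intros; omega)) f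
  exists_decomp := fun M => by
    obtain ⟨B, A, f, g, h, hB, hA, H⟩ := w_decomp hE hall 0 M
    exact ⟨B, A, f, g, h, hB, RO.shift hE hA _ (by intros; omega), H⟩

lemma mem_shift_le (hE : Cells E) {n : ℤ} {X : C} (h : WLE E n X) :
    X ∈ shiftedClass C {X | WLE E 0 X} n := LO.shift hE h _ (by intros; omega)
lemma mem_shift_ge (hE : Cells E) {n : ℤ} {X : C} (h : WGE E n X) :
    X ∈ shiftedClass C {X | WGE E 0 X} n := RO.shift hE h _ (by intros; omega)

lemma hall_of (hE : Cells E) (Q : Set C) (hQ : ∀ X ∈ Q, ∃ m, FS (E m 0) X) {X : C}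
    (hX : TriaClosure C Q X) : HasST E X := by
  induction hX with
  | base h =>
    obtain ⟨m, hm⟩ := hQ _ h
    exact ⟨m, 0, ST.single hm trivial⟩
  | iso e _ ih => exact ih.iso e
  | shift n _ ih => exact ih.shift hE n
  | @ext T hT _ _ ih1 ih3 =>
    obtain ⟨a, b, h3⟩ := ih3
    exact hasST_ext hE h3 ih1 (f := T.mor₁) (g := T.mor₂) (δ := T.mor₃) hT

lemma heart_iff (hE : Cells E) (hall : ∀ X, HasST E X) (Q : Set C)
    (hQ : ∀ X ∈ Q, ∃ m, FS (E m 0) X) (hQ' : ∀ m X, FS (E m 0) X → X ∈ Q) (X : C) :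
    (TLE E 0 X ∧ TGE E 0 X) ↔ ExtClosure C Q X := by
  constructor
  · rintro ⟨h, h'⟩
    obtain ⟨m, s, hs⟩ := heart_st hE (hall X) h h'
    clear h h'
    induction hs with
    | zero h => exact .base (hQ' 0 _ (.zero h))
    | @cons m0 s0 m s d X X1 f g k hl hφ H hd hX ih =>
      subst hφ
      exact ExtClosure.ext (T := Triangle.mk f g k) H (.base (hQ' m _ hd)) ih
  · intro h
    induction h with
    | base h =>
      obtain ⟨m, hm⟩ := hQ _ h
      exact st_heart hE (ST.single hm rfl)
    | iso e _ ih => exact ⟨LO.iso ih.1 e, RO.iso ih.2 e⟩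
    | @ext T hT _ _ ih1 ih3 =>
      have H : Tri T.mor₁ T.mor₂ T.mor₃ := hT
      exact ⟨LO.ext H ih1.1 ih3.1, RO.ext H ih1.2 ih3.2⟩

lemma FS.toFinset {X : C} (h : FS (WC E 0) X) :
    ∃ s : Finset ℤ, FS (fun Y => ∃ m ∈ s, E m (-m) Y) X := by
  induction h with
  | zero h => exact ⟨∅, .zero h⟩
  | cons hG h d ih =>
    obtain ⟨s, hs⟩ := ih
    obtain ⟨m, r, hm, hG⟩ := hG
    obtain rfl : r = -m := by omega
    refine ⟨insert m s, .cons ⟨m, by simp, hG⟩ (hs.mono fun Y hY => ?_) d⟩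
    obtain ⟨j, hj, hY⟩ := hY
    exact ⟨j, by simp [hj], hY⟩

lemma FS.splitInsert {a : ℤ} {s : Finset ℤ} {X : C}
    (h : FS (fun Y => ∃ m ∈ insert a s, E m (-m) Y) X) :
    ∃ (A B : C), FS (E a (-a)) A ∧ FS (fun Y => ∃ m ∈ s, E m (-m) Y) B ∧ Nonempty (Dec A B X) := by
  induction h with
  | @zero X h => exact ⟨X, X, .zero h, .zero h, ⟨Dec.unit h X⟩⟩
  | @cons G X' X hG h d ih =>
    obtain ⟨A, B, hA, hB, ⟨d0⟩⟩ := ih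
    obtain ⟨m, hm, hG⟩ := hG
    by_cases hma : m = a
    · subst hma
      obtain ⟨d'⟩ := d0.symm.assoc d.symm (Dec.mk' A G)
      exact ⟨_, B, FS.sum hA (.single hG) (Dec.mk' A G), hB, ⟨d'.symm⟩⟩
    · have hms : m ∈ s := by simpa [hma] using hm
      obtain ⟨d'⟩ := d0.assoc d.symm (Dec.mk' B G)
      exact ⟨A, _, hA, FS.sum hB (.single ⟨m, hms, hG⟩) (Dec.mk' B G), ⟨d'⟩⟩

variable [HasFiniteBiproducts C]

/-- split off one summand -/
noncomputable def decInsert {a : ℤ} {s : Finset ℤ} (ha : a ∉ s) (G : ℤ → C) :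
    Dec (G a) (⨁ fun i : s => G i) (⨁ fun i : (insert a s : Finset ℤ) => G i) := by
  let F : ↥(insert a s : Finset ℤ) → C := fun i => G i
  let a' : (insert a s : Finset ℤ) := ⟨a, by simp⟩
  let t : s → (insert a s : Finset ℤ) := fun i => ⟨i, by simp⟩
  have ht : ∀ i j, i ≠ j → t i ≠ t j := fun i j h h' =>
    h (Subtype.ext (show (t i).1 = (t j).1 from congrArg Subtype.val h'))
  have hta : ∀ i, t i ≠ a' := fun i h => ha (by
    have := congrArg Subtype.val h
    change (i : ℤ) = a at this
    rw [← this]; exact i.2)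
  have e1 : biproduct.ι F a' ≫ biproduct.lift (fun k : s => biproduct.π F (t k)) = 0 := by
    apply biproduct.hom_ext; intro k
    rw [Category.assoc, biproduct.lift_π, biproduct.ι_π_ne _ (hta k).symm, zero_comp]
  have e2 : biproduct.desc (fun k : s => biproduct.ι F (t k)) ≫ biproduct.π F a' = 0 := by
    apply biproduct.hom_ext'; intro k
    rw [← Category.assoc, biproduct.ι_desc, biproduct.ι_π_ne _ (hta k), comp_zero]
  have e3 : biproduct.desc (fun k : s => biproduct.ι F (t k)) ≫
      biproduct.lift (fun k : s => biproduct.π F (t k)) = 𝟙 (⨁ fun i : s => F (t i)) := by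
    apply biproduct.hom_ext'; intro j
    apply biproduct.hom_ext; intro k
    by_cases h : j = k
    · subst h; simp
    · simp [biproduct.ι_π_ne _ h, biproduct.ι_π_ne _ (ht _ _ h)]
  refine ⟨biproduct.ι F a', biproduct.desc (fun k : s => biproduct.ι F (t k)),
    biproduct.π F a', biproduct.lift (fun k : s => biproduct.π F (t k)), ?_, e3, e1, e2, ?_⟩
  · exact biproduct.ι_π_self F a'
  · apply biproduct.hom_ext'
    rintro ⟨j, hj⟩
    rw [Preadditive.comp_add, Category.comp_id]
    by_cases hja : j = a
    · subst hja
      have e4 := biproduct.ι_π_self F a'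
      change biproduct.ι F a' ≫ _ + biproduct.ι F a' ≫ _ = biproduct.ι F a'
      rw [← Category.assoc, e4, ← Category.assoc, e1, Category.id_comp, zero_comp, add_zero]
    · have hjs : j ∈ s := by simpa [hja] using hj
      have e5 : biproduct.ι (fun k : s => F (t k)) ⟨j, hjs⟩ ≫
        biproduct.desc (fun k : s => biproduct.ι F (t k)) = biproduct.ι F ⟨j, hj⟩ := by
          rw [biproduct.ι_desc]
      change biproduct.ι F ⟨j, hj⟩ ≫ _ + biproduct.ι F ⟨j, hj⟩ ≫ _ = biproduct.ι F ⟨j, hj⟩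
      rw [← e5]
      simp only [Category.assoc]
      rw [← Category.assoc (biproduct.desc _) (biproduct.π F a'), e2,
        ← Category.assoc (biproduct.desc _) (biproduct.lift _), e3]
      simp

lemma FS.toSum (hE : Cells E) (P : ℤ → Set C) (hP' : ∀ m X, FS (E m 0) X → X ∈ P m)
    (s : Finset ℤ) : ∀ {X : C}, FS (fun Y => ∃ m ∈ s, E m (-m) Y) X →
    ∃ Xm : ℤ → C, (∀ i, Xm i ∈ P i) ∧ Nonempty (X ≅ ⨁ fun i : s => (Xm i)⟦(-(i : ℤ))⟧) := by
  classical
  induction s using Finset.induction_on with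
  | empty =>
    intro X h
    have hX : IsZero X := by
      cases h with
      | zero h => exact h
      | cons hG _ _ => obtain ⟨m, hm, _⟩ := hG; simp at hm
    refine ⟨fun _ => X, fun i => hP' i _ (.zero hX), ⟨IsZero.iso hX ?_⟩⟩
    · rw [IsZero.iff_id_eq_zero]
      apply biproduct.hom_ext
      rintro ⟨j, hj⟩
      simp at hj
  | insert a s ha ih =>
    intro X h
    obtain ⟨A, B, hA, hB, ⟨d⟩⟩ := h.splitInsert
    obtain ⟨Xm, hXm, ⟨e⟩⟩ := ih hB
    refine ⟨Function.update Xm a (A⟦a⟧), fun i => ?_, ⟨?_⟩⟩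
    · by_cases hi : i = a
      · subst hi
        rw [Function.update_self]
        exact hP' _ _ (by simpa using hE.shiftFS i hA)
      · rw [Function.update_of_ne hi]; exact hXm i
    · let G : ℤ → C := fun i => (Function.update Xm a (A⟦a⟧) i)⟦-i⟧
      have eA : A ≅ G a := ((shiftEquiv C a).unitIso.app A) ≪≫
        eqToIso (by simp [G])
      have eB : (⨁ fun i : s => (Xm i)⟦(-(i : ℤ))⟧) ≅ ⨁ fun i : s => G i :=
        biproduct.mapIso fun i => eqToIso (by
          have : (i : ℤ) ≠ a := fun h => ha (h ▸ i.2)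
          simp [G, Function.update_of_ne this])
      exact ((d.iso2 (e ≪≫ eB)).symm.iso2 eA).symm.uniq (decInsert ha G)

lemma wheart_iff (hE : Cells E) (hall : ∀ X, HasST E X) (P : ℤ → Set C)
    (hP : ∀ m, ∀ X ∈ P m, FS (E m 0) X) (hP' : ∀ m X, FS (E m 0) X → X ∈ P m) (Y : C) :
    Y ∈ wEq C {X | WLE E 0 X} {X | WGE E 0 X} 0 ↔
        ∃ (s : Finset ℤ) (Xm : s → C), (∀ i : s, Xm i ∈ P (i : ℤ)) ∧
          Nonempty (Y ≅ ⨁ fun i : s => (Xm i)⟦(-(i : ℤ))⟧) := by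
  constructor
  · rintro ⟨h1, h2⟩
    have e : Y⟦(-0 : ℤ)⟧ ≅ Y := (shiftFunctorZero' C (-0 : ℤ) (by simp)).app Y
    obtain ⟨s, hs⟩ := FS.toFinset (w_heart hE hall (LO.iso h1 e) (RO.iso h2 e))
    obtain ⟨Xm, h, e⟩ := FS.toSum hE P hP' s hs
    exact ⟨s, fun i => Xm i, fun i => h i, e⟩
  · rintro ⟨s, Xm, h, ⟨e⟩⟩
    have key : ∀ i : s, FS (E i (-(i : ℤ))) ((Xm i)⟦(-(i : ℤ))⟧) := fun i => by
      simpa using hE.shiftFS (-(i : ℤ)) (hP _ _ (h i))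
    refine ⟨mem_shift_le hE (LO.iso ?_ e.symm), mem_shift_ge hE (RO.iso ?_ e.symm)⟩
    · intro m r hm G hG f
      apply biproduct.hom_ext'
      intro j
      rw [comp_zero]
      exact (key j).lo hE (φ := fun m s => 0 < m + s) (by intros; omega) m r hm G hG _
    · intro m r hm G hG f
      apply biproduct.hom_ext
      intro j
      rw [zero_comp]
      exact (key j).ro hE (φ := fun m s => m + s < 0) (by intros; omega) m r hm G hG _

end Part5

/-- Given a family of semi-simple abelian full subcategories
`A_m ⊆ C` generating `C` as a triangulated category and satisfying
`A_m ⊥ A_j[s]` whenever `s < 0`, or `s > m - j`, or `s = 0 ∧ m > j`, there exist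
a bounded weight structure `w` and a bounded t-structure `t` on `C` which are
transversal, such that `C_{w=0}` consists exactly of the finite direct sums of
objects `X_m[-m]` with `X_m ∈ A_m`, and the heart of `t` is the smallest
extension-stable full subcategory of `C` containing all the `A_m`. -/
theorem statement12 [HasFiniteBiproducts C] (P : ℤ → Set C)
    (hss : ∀ m : ℤ, IsSemisimpleSub (P m))
    (hgen : ∀ X : C, TriaClosure C (⋃ m : ℤ, P m) X)
    (horth : ∀ m j s : ℤ, (s < 0 ∨ s > m - j ∨ (s = 0 ∧ m > j)) →
      ∀ X ∈ P m, ∀ Y ∈ P j, ∀ f : X ⟶ (Y⟦s⟧), f = 0) :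
    ∃ (le ge : Set C) (t : TStructure C),
      IsWeightStructure C le ge ∧ WBounded C le ge ∧ TBounded C t ∧
      Transversal C le ge t ∧
      (∀ Y : C, Y ∈ wEq C le ge 0 ↔
        ∃ (s : Finset ℤ) (Xm : s → C), (∀ i : s, Xm i ∈ P (i : ℤ)) ∧
          Nonempty (Y ≅ ⨁ fun i : s => (Xm i)⟦(-(i : ℤ))⟧)) ∧
      (∀ X : C, X ∈ heartSet C t ↔ ExtClosure C (⋃ m : ℤ, P m) X) := by
  choose hiso S hSP hS0 hS hPS using hss
  have hE : Cells (cellsOf S) := cellsOf_cells S hS fun m j s h X hX Y hY =>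
    horth m j s h X (hSP m hX) Y (hSP j hY)
  have e0 : ∀ X : C, X ≅ X⟦(0 : ℤ)⟧ := fun X => ((shiftFunctorZero C ℤ).app X).symm
  have hP : ∀ m, ∀ X ∈ P m, FS (cellsOf S m 0) X := fun m X hX => by
    obtain ⟨n, F, hF, ⟨e⟩⟩ := (hPS m X).1 hX
    exact (FS.biproduct F fun i => ⟨F i, hF i, ⟨e0 _⟩⟩).iso e.symm
  have hP' : ∀ m X, FS (cellsOf S m 0) X → X ∈ P m := fun m X hX => by
    obtain ⟨n, F, hF, ⟨e⟩⟩ := hX.exists_biproduct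
    choose G hG hi using hF
    exact (hPS m X).2 ⟨n, G, hG, ⟨e ≪≫ biproduct.mapIso fun i => (hi i).some ≪≫ (e0 _).symm⟩⟩
  have hQ : ∀ X ∈ ⋃ m : ℤ, P m, ∃ m, FS (cellsOf S m 0) X := fun X hX => by
    obtain ⟨m, hm⟩ := Set.mem_iUnion.1 hX
    exact ⟨m, hP m X hm⟩
  have hall : ∀ X, HasST (cellsOf S) X := fun X => hall_of hE _ hQ (hgen X)
  refine ⟨{X | WLE (cellsOf S) 0 X}, {X | WGE (cellsOf S) 0 X}, tOf hE hall, wStr hE hall,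
    fun X => ?_, fun X => ?_, fun X hX m => ?_, fun Y => wheart_iff hE hall P hP hP' Y,
    fun X => heart_iff hE hall _ hQ (fun m X hX => Set.mem_iUnion.2 ⟨m, hP' m X hX⟩) X⟩
  · obtain ⟨⟨n, h⟩, ⟨n', h'⟩, -⟩ := bounded hE (hall X)
    exact ⟨⟨n, mem_shift_le hE h⟩, ⟨n', mem_shift_ge hE h'⟩⟩
  · exact (bounded hE (hall X)).2.2
  · obtain ⟨a, b, hs⟩ := heart_st hE (hall X) hX.1 hX.2
    obtain ⟨B, A, f, g, h, H, h1, h2, h3, h4⟩ := nice hE hs m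
    exact ⟨B, A, f, g, h, H, mem_shift_le hE h1, mem_shift_ge hE h2, h3, h4⟩

end PaperWeights
end

section
/- Let (C, D, E, i_*, j^*, i^*, i^!, j_!, j_*) be gluing data and let t_D be a t-structure on D. Then for any X ∈ Obj C, any distinguished triangle A' → j^*X → B' in E admits a lift to a distinguished triangle A → X → B in C (i.e. applying j^* to A → X → B yields a triangle isomorphic to A' → j^*X → B') such that i^*A ∈ D^{t_D≤0} and i^!B ∈ D^{t_D≥1}. -/
namespace PaperGluing

open CategoryTheory CategoryTheory.Limits CategoryTheory.Pretriangulated CategoryTheory.Triangulated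

universe v v₂ v₃ v₄ u u₂ u₃ u₄

section Generic

variable (A : Type u₄) [Category.{v₄} A] [HasZeroObject A] [Preadditive A] [HasShift A ℤ]
  [∀ n : ℤ, (shiftFunctor A n).Additive] [Pretriangulated A]

/-- The class `A^{t=0}` of a `t`-structure. -/
def heartSet (t : TStructure A) : Set A := fun X => t.le 0 X ∧ t.ge 0 X

/-- The heart of a `t`-structure, as a full subcategory. -/
abbrev THeart (t : TStructure A) := ObjectProperty.FullSubcategory (fun X : A => X ∈ heartSet A t)

/-- The inclusion of the heart. -/
abbrev heartIncl (t : TStructure A) : THeart A t ⥤ A :=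
  ObjectProperty.ι (fun X : A => X ∈ heartSet A t)

/-- Truncation data for a `t`-structure `t` (such data always exists):
functors `τ_{≤0}`, `τ_{≥0}` with their universal properties. -/
structure TruncData (t : TStructure A) where
  truncLE : A ⥤ A
  truncGE : A ⥤ A
  εLE : truncLE ⟶ 𝟭 A
  ηGE : 𝟭 A ⟶ truncGE
  mem_le : ∀ X : A, t.le 0 (truncLE.obj X)
  mem_ge : ∀ X : A, t.ge 0 (truncGE.obj X)
  le_univ : ∀ (W X : A), t.le 0 W →
    Function.Bijective (fun f : W ⟶ truncLE.obj X => f ≫ εLE.app X)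
  ge_univ : ∀ (X W : A), t.ge 0 W →
    Function.Bijective (fun f : truncGE.obj X ⟶ W => ηGE.app X ≫ f)
  mem_heart : ∀ X : A, truncGE.obj (truncLE.obj X) ∈ heartSet A t
  isoHeart : ∀ X : A, X ∈ heartSet A t → (truncGE.obj (truncLE.obj X) ≅ X)

variable {A}

/-- The zeroth homology functor `H^t_0 : A ⥤ Ht`. -/
def TruncData.H₀ {t : TStructure A} (τ : TruncData A t) : A ⥤ THeart A t :=
  ObjectProperty.lift _ (τ.truncLE ⋙ τ.truncGE) (fun X => τ.mem_heart X)

end Generic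

variable {C : Type u} {D : Type u₂} {E : Type u₃}
  [Category.{v} C] [Category.{v₂} D] [Category.{v₃} E]
  [HasZeroObject C] [HasZeroObject D] [HasZeroObject E]
  [Preadditive C] [Preadditive D] [Preadditive E]
  [HasShift C ℤ] [HasShift D ℤ] [HasShift E ℤ]
  [∀ n : ℤ, (shiftFunctor C n).Additive] [∀ n : ℤ, (shiftFunctor D n).Additive]
  [∀ n : ℤ, (shiftFunctor E n).Additive]
  [Pretriangulated C] [Pretriangulated D] [Pretriangulated E]

/-- The conditions, beyond the exactness of the six functors and the four
adjunctions, making `(C, D, E, i_*, j^*, i^*, i^!, j_!, j_*)` into gluing data: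
`i_*` is a full embedding, `j^*` is the localization of `C` by `i_*(D)` (its
kernel is the essential image of `i_*`), the two adjunction triangles are
distinguished, `i^* j_! = 0`, `i^! j_* = 0`, and the four adjunction
transformations `i^* i_* → id → i^! i_*`, `j^* j_* → id → j^* j_!` are
isomorphisms. -/
structure GluingCond (iS : D ⥤ C) (jU : C ⥤ E) (iU iE : C ⥤ D) (jL jR : E ⥤ C)
    (adj₁ : iU ⊣ iS) (adj₂ : iS ⊣ iE) (adj₃ : jL ⊣ jU) (adj₄ : jU ⊣ jR) :
    Prop where
  full_iS : iS.Full
  faithful_iS : iS.Faithful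
  ker_jU : ∀ X : C, IsZero (jU.obj X) ↔ ∃ Y : D, Nonempty (iS.obj Y ≅ X)
  tri₁ : ∀ X : C, ∃ δ : iS.obj (iU.obj X) ⟶ (jL.obj (jU.obj X))⟦(1 : ℤ)⟧,
    Triangle.mk (adj₃.counit.app X) (adj₁.unit.app X) δ ∈ distTriang C
  tri₂ : ∀ X : C, ∃ δ : jR.obj (jU.obj X) ⟶ (iS.obj (iE.obj X))⟦(1 : ℤ)⟧,
    Triangle.mk (adj₂.counit.app X) (adj₄.unit.app X) δ ∈ distTriang C
  vanish₁ : ∀ Y : E, IsZero (iU.obj (jL.obj Y))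
  vanish₂ : ∀ Y : E, IsZero (iE.obj (jR.obj Y))
  iso₁ : ∀ Y : D, IsIso (adj₁.counit.app Y)
  iso₂ : ∀ Y : D, IsIso (adj₂.unit.app Y)
  iso₃ : ∀ X : E, IsIso (adj₃.unit.app X)
  iso₄ : ∀ X : E, IsIso (adj₄.counit.app X)

/-- The `t`-structure `tC` is glued from `tD` and `tE` (the three t-structures
are then called compatible). -/
def GluedTS (jU : C ⥤ E) (iU iE : C ⥤ D)
    (tC : TStructure C) (tD : TStructure D) (tE : TStructure E) : Prop :=
  ∀ X : C, (tC.le 0 X ↔ (tE.le 0 (jU.obj X) ∧ tD.le 0 (iU.obj X))) ∧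
    (tC.ge 0 X ↔ (tE.ge 0 (jU.obj X) ∧ tD.ge 0 (iE.obj X)))

/-- The intermediate image `j_{!*}X'` of an object `X'` of the heart of `tE`:
the image of `H^{t_C}_0(j_! X') ⟶ H^{t_C}_0(j_* X')`, where the morphism
`j_! X' ⟶ j_* X'` is obtained from the adjunctions via `j^* j_! ≅ id ≅ j^* j_*`. -/
noncomputable def jMiddle (jU : C ⥤ E) (jL jR : E ⥤ C)
    (adj₃ : jL ⊣ jU) (adj₄ : jU ⊣ jR)
    (hiso : ∀ Y : E, IsIso (adj₃.unit.app Y))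
    {tC : TStructure C} (τC : TruncData C tC) [HasImages (THeart C tC)]
    {tE : TStructure E} (X' : THeart E tE) : THeart C tC :=
  haveI := hiso X'.obj
  image (τC.H₀.map
    ((adj₄.homEquiv (jL.obj X'.obj) X'.obj) (inv (adj₃.unit.app X'.obj))))

/-- Two distinguished triangles with compatible isomorphisms in positions 2 and 3. -/
lemma exists_iso₁ {X₁ X₂ X₃ Y₁ Y₃ : C} {f₁ : X₁ ⟶ X₂} {g₁ : X₂ ⟶ X₃} {h₁ : X₃ ⟶ X₁⟦(1 : ℤ)⟧}
    {f₂ : Y₁ ⟶ X₂} {g₂ : X₂ ⟶ Y₃} {h₂ : Y₃ ⟶ Y₁⟦(1 : ℤ)⟧}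
    (hT₁ : Triangle.mk f₁ g₁ h₁ ∈ distTriang C) (hT₂ : Triangle.mk f₂ g₂ h₂ ∈ distTriang C)
    (c : X₃ ⟶ Y₃) (hc : IsIso c) (comm : g₁ ≫ c = g₂) :
    ∃ e₁ : X₁ ≅ Y₁, f₁ = e₁.hom ≫ f₂ := by
  have comm' : g₁ ≫ c = 𝟙 X₂ ≫ g₂ := by rw [comm, Category.id_comp]
  obtain ⟨a, ha, ha'⟩ := complete_distinguished_triangle_morphism₁ _ _ hT₁ hT₂ (𝟙 X₂) c comm'
  let φ : Triangle.mk f₁ g₁ h₁ ⟶ Triangle.mk f₂ g₂ h₂ :=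
    { hom₁ := a, hom₂ := 𝟙 X₂, hom₃ := c, comm₁ := ha, comm₂ := comm', comm₃ := ha' }
  have ia : IsIso a := isIso₁_of_isIso₂₃ φ hT₁ hT₂ (inferInstanceAs (IsIso (𝟙 X₂))) hc
  have ha₂ : f₁ ≫ 𝟙 X₂ = a ≫ f₂ := ha
  exact ⟨@asIso _ _ X₁ Y₁ a ia, (Category.comp_id f₁).symm.trans ha₂⟩

/-- Given gluing data and a t-structure `t_D` on `D`, any
distinguished triangle `A' → j^*X → B'` in `E` lifts to a distinguished
triangle `A → X → B` in `C` such that `i^*A ∈ D^{t_D ≤ 0}` and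
`i^!B ∈ D^{t_D ≥ 1}`. -/
theorem statement14
    (iS : D ⥤ C) (jU : C ⥤ E) (iU iE : C ⥤ D) (jL jR : E ⥤ C)
    [iS.CommShift ℤ] [jU.CommShift ℤ] [iU.CommShift ℤ] [iE.CommShift ℤ]
    [jL.CommShift ℤ] [jR.CommShift ℤ]
    [iS.IsTriangulated] [jU.IsTriangulated] [iU.IsTriangulated]
    [iE.IsTriangulated] [jL.IsTriangulated] [jR.IsTriangulated]
    (adj₁ : iU ⊣ iS) (adj₂ : iS ⊣ iE) (adj₃ : jL ⊣ jU) (adj₄ : jU ⊣ jR)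
    (hg : GluingCond iS jU iU iE jL jR adj₁ adj₂ adj₃ adj₄)
    (tD : TStructure D) (X : C) (A' B' : E)
    (f' : A' ⟶ jU.obj X) (g' : jU.obj X ⟶ B') (h' : B' ⟶ A'⟦(1 : ℤ)⟧)
    (hT : Triangle.mk f' g' h' ∈ distTriang E) :
    ∃ (A B : C) (f : A ⟶ X) (g : X ⟶ B) (h : B ⟶ A⟦(1 : ℤ)⟧),
      (Triangle.mk f g h ∈ distTriang C) ∧
      Nonempty (jU.mapTriangle.obj (Triangle.mk f g h) ≅ Triangle.mk f' g' h') ∧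
      tD.le 0 (iU.obj A) ∧ tD.ge 1 (iE.obj B) := by
  obtain ⟨Y, y, y', hY⟩ := distinguished_cocone_triangle₁ (adj₄.homEquiv X B' g')
  obtain ⟨N, P, hN, hP, n, p, p', hNP⟩ := tD.exists_triangle_zero_one (iU.obj Y)
  obtain ⟨A, a, a', hA⟩ := distinguished_cocone_triangle₁ (adj₁.homEquiv Y P p)
  obtain ⟨B, g, h, hB⟩ := distinguished_cocone_triangle (a ≫ y)
  have := hg.full_iS
  have hz : ∀ T : D, IsZero (jU.obj (iS.obj T)) := fun T => (hg.ker_jU _).2 ⟨T, ⟨Iso.refl _⟩⟩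
  have z₁ : ∀ (T : D) (u : iS.obj T ⟶ jR.obj B'), u = 0 := fun T u => by
    apply (adj₄.homEquiv _ _).symm.injective
    exact (hz T).eq_of_src _ _
  have z₂ : ∀ (T : D) (_ : tD.le 0 T) (u : iS.obj T ⟶ iS.obj P), u = 0 := fun T hT u => by
    obtain ⟨v, rfl⟩ := iS.map_surjective u
    rw [tD.zero' v hT hP, iS.map_zero]
  refine ⟨A, B, a ≫ y, g, h, hB, ?_, ?_, ?_⟩
  · have hjY : Triangle.mk (jU.map y) (jU.map (adj₄.homEquiv X B' g'))
        (jU.map y' ≫ (jU.commShiftIso (1 : ℤ)).hom.app Y) ∈ distTriang E :=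
      jU.map_distinguished _ hY
    obtain ⟨e, he⟩ := exists_iso₁ hjY hT (adj₄.counit.app B') (hg.iso₄ B') (by
        rw [← adj₄.homEquiv_counit, Equiv.symm_apply_apply])
    have ia : IsIso (jU.map a) :=
      (Triangle.isZero₃_iff_isIso₁ _ (jU.map_distinguished _ hA)).1 (hz P)
    have hc : jU.map (a ≫ y) ≫ (Iso.refl (jU.obj X)).hom =
        (@asIso _ _ (jU.obj A) (jU.obj Y) (jU.map a) ia ≪≫ e).hom ≫ f' := by
      simp [he]
    exact ⟨isoTriangleOfIso₁₂ _ _ (jU.map_distinguished _ hB) hT _ (Iso.refl (jU.obj X)) hc⟩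
  · have hiA : Triangle.mk (iU.map a) (iU.map (adj₁.homEquiv Y P p))
        (iU.map a' ≫ (iU.commShiftIso (1 : ℤ)).hom.app A) ∈ distTriang D :=
      iU.map_distinguished _ hA
    obtain ⟨e, -⟩ := exists_iso₁ hiA hNP (adj₁.counit.app P) (hg.iso₁ P) (by
        rw [← adj₁.homEquiv_counit, Equiv.symm_apply_apply])
    exact (tD.le 0).prop_of_iso e.symm hN
  · rw [TStructure.ge_iff_isGE, tD.isGE_iff_orthogonal 0 1 (by norm_num)]
    intro T f hf
    have hf : tD.le 0 T := hf.le
    apply (adj₂.homEquiv _ _).symm.injective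
    generalize (adj₂.homEquiv T B).symm f = w
    have hw : w ≫ h = 0 := by
      have h0 : ((w ≫ h) ≫ a⟦(1 : ℤ)⟧') ≫ y⟦(1 : ℤ)⟧' = 0 := by
        have h00 : h ≫ (a ≫ y)⟦(1 : ℤ)⟧' = 0 := comp_distTriang_mor_zero₃₁ _ hB
        rw [Functor.map_comp] at h00
        rw [Category.assoc, Category.assoc, h00, comp_zero]
      have h1 : (w ≫ h) ≫ a⟦(1 : ℤ)⟧' = 0 := by
        obtain ⟨v, hv⟩ : ∃ v : iS.obj T ⟶ jR.obj B', (w ≫ h) ≫ a⟦(1 : ℤ)⟧' = v ≫ y' :=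
          Triangle.coyoneda_exact₁ _ hY ((w ≫ h) ≫ a⟦(1 : ℤ)⟧') h0
        rw [hv, z₁ T v, zero_comp]
      obtain ⟨v, hv⟩ : ∃ v : iS.obj T ⟶ iS.obj P, w ≫ h = v ≫ a' :=
        Triangle.coyoneda_exact₁ _ hA (w ≫ h) h1
      rw [hv, z₂ T hf v, zero_comp]
    obtain ⟨x, hx⟩ : ∃ x : iS.obj T ⟶ X, w = x ≫ g := Triangle.coyoneda_exact₃ _ hB w hw
    obtain ⟨v, hv⟩ : ∃ v : iS.obj T ⟶ Y, x = v ≫ y := Triangle.coyoneda_exact₂ _ hY x (z₁ T _)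
    obtain ⟨v', hv'⟩ : ∃ v' : iS.obj T ⟶ A, v = v' ≫ a :=
      Triangle.coyoneda_exact₂ _ hA v (z₂ T hf _)
    have hc : (a ≫ y) ≫ g = 0 := comp_distTriang_mor_zero₁₂ _ hB
    have hw0 : w = 0 := by
      rw [hx, hv, hv']
      simp only [Category.assoc] at hc ⊢
      rw [hc, comp_zero]
    rw [hw0]
    simp [Adjunction.homEquiv_counit]

end PaperGluing
end

section
/- Let (C, D, E, i_*, j^*, i^*, i^!, j_!, j_*) be gluing data with t-structures t_D on D and t_E on E, and suppose the t-structure t on C glued from t_D and t_E exists. Then: i_* and j^* are t-exact, j_! and i^* are right t-exact, j_* and i^! are left t-exact (with respect to t_D, t, t_E as appropriate); moreover, t is the unique t-structure on C for which both i_* and j^* are t-exact. -/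
namespace PaperGluing

open CategoryTheory CategoryTheory.Limits CategoryTheory.Pretriangulated CategoryTheory.Triangulated

universe v v₂ v₃ v₄ u u₂ u₃ u₄

variable {C : Type u} {D : Type u₂} {E : Type u₃}
  [Category.{v} C] [Category.{v₂} D] [Category.{v₃} E]
  [HasZeroObject C] [HasZeroObject D] [HasZeroObject E]
  [Preadditive C] [Preadditive D] [Preadditive E]
  [HasShift C ℤ] [HasShift D ℤ] [HasShift E ℤ]
  [∀ n : ℤ, (shiftFunctor C n).Additive] [∀ n : ℤ, (shiftFunctor D n).Additive]
  [∀ n : ℤ, (shiftFunctor E n).Additive]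
  [Pretriangulated C] [Pretriangulated D] [Pretriangulated E]

section Helpers

variable {A : Type u₄} [Category.{v₄} A] [HasZeroObject A] [Preadditive A] [HasShift A ℤ]
  [∀ n : ℤ, (shiftFunctor A n).Additive] [Pretriangulated A]

lemma le_iff_orth (t : TStructure A) (n m : ℤ) (h : n + 1 = m) (X : A) :
    t.le n X ↔ ∀ (Y : A) (f : X ⟶ Y), t.ge m Y → f = 0 := by
  rw [t.le_iff_isLE, t.isLE_iff_orthogonal n m h]
  exact ⟨fun H Y f hY => H Y f ⟨hY⟩, fun H Y f hY => H Y f hY.ge⟩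

lemma ge_iff_orth (t : TStructure A) (n m : ℤ) (h : n + 1 = m) (X : A) :
    t.ge m X ↔ ∀ (Y : A) (f : Y ⟶ X), t.le n Y → f = 0 := by
  rw [t.ge_iff_isGE, t.isGE_iff_orthogonal n m h]
  exact ⟨fun H Y f hY => H Y f ⟨hY⟩, fun H Y f hY => H Y f hY.le⟩

lemma le_of_isZero (t : TStructure A) (n : ℤ) {X : A} (hX : IsZero X) : t.le n X :=
  (le_iff_orth t n _ rfl X).2 fun _ _ _ => hX.eq_of_src _ _

lemma ge_of_isZero (t : TStructure A) (n : ℤ) {X : A} (hX : IsZero X) : t.ge n X :=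
  (ge_iff_orth t (n - 1) n (by lia) X).2 fun _ _ _ => hX.eq_of_tgt _ _

lemma le_iff_shift (t : TStructure A) (n : ℤ) (X : A) : t.le n X ↔ t.le 0 (X⟦n⟧) := by
  rw [t.le_iff_isLE, t.le_iff_isLE, t.isLE_shift_iff X n n 0 (by lia)]

lemma ge_iff_shift (t : TStructure A) (n : ℤ) (X : A) : t.ge n X ↔ t.ge 0 (X⟦n⟧) := by
  rw [t.ge_iff_isGE, t.ge_iff_isGE, t.isGE_shift_iff X n n 0 (by lia)]

/-- If every aisle and coaisle of `t'` is contained in that of `t`, they agree. -/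
lemma tstructure_eq_of_le (t t' : TStructure A)
    (h₁ : ∀ X, t'.le 0 X → t.le 0 X) (h₂ : ∀ X, t'.ge 0 X → t.ge 0 X) (n : ℤ) (X : A) :
    (t'.le n X ↔ t.le n X) ∧ (t'.ge n X ↔ t.ge n X) := by
  have h₁' : ∀ n X, t'.le n X → t.le n X := fun n X h =>
    (le_iff_shift t n X).2 (h₁ _ ((le_iff_shift t' n X).1 h))
  have h₂' : ∀ n X, t'.ge n X → t.ge n X := fun n X h =>
    (ge_iff_shift t n X).2 (h₂ _ ((ge_iff_shift t' n X).1 h))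
  refine ⟨⟨h₁' n X, fun h => ?_⟩, ⟨h₂' n X, fun h => ?_⟩⟩
  · exact (le_iff_orth t' n _ rfl X).2 fun Y f hY =>
      (le_iff_orth t n _ rfl X).1 h Y f (h₂' _ _ hY)
  · exact (ge_iff_orth t' (n - 1) n (by lia) X).2 fun Y f hY =>
      (ge_iff_orth t (n - 1) n (by lia) X).1 h Y f (h₁' _ _ hY)

end Helpers

lemma map_le (F : D ⥤ C) [F.CommShift ℤ] (tD : TStructure D) (tC : TStructure C)
    (h : ∀ Y, tD.le 0 Y → tC.le 0 (F.obj Y)) (n : ℤ) (Y : D) (hY : tD.le n Y) :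
    tC.le n (F.obj Y) :=
  (le_iff_shift tC n _).2 ((tC.le 0).prop_of_iso ((F.commShiftIso n).app Y)
    (h _ ((le_iff_shift tD n Y).1 hY)))

lemma map_ge (F : D ⥤ C) [F.CommShift ℤ] (tD : TStructure D) (tC : TStructure C)
    (h : ∀ Y, tD.ge 0 Y → tC.ge 0 (F.obj Y)) (n : ℤ) (Y : D) (hY : tD.ge n Y) :
    tC.ge n (F.obj Y) :=
  (ge_iff_shift tC n _).2 ((tC.ge 0).prop_of_iso ((F.commShiftIso n).app Y)
    (h _ ((ge_iff_shift tD n Y).1 hY)))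

/-- Given gluing data with t-structures `t_D`, `t_E` and the
glued t-structure `t_C` on `C`: `i_*` and `j^*` are t-exact, `j_!` and `i^*`
are right t-exact, `j_*` and `i^!` are left t-exact; moreover the glued
t-structure is the unique t-structure on `C` making `i_*` and `j^*` t-exact. -/
theorem statement15
    (iS : D ⥤ C) (jU : C ⥤ E) (iU iE : C ⥤ D) (jL jR : E ⥤ C)
    [iS.CommShift ℤ] [jU.CommShift ℤ] [iU.CommShift ℤ] [iE.CommShift ℤ]
    [jL.CommShift ℤ] [jR.CommShift ℤ]
    [iS.IsTriangulated] [jU.IsTriangulated] [iU.IsTriangulated]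
    [iE.IsTriangulated] [jL.IsTriangulated] [jR.IsTriangulated]
    (adj₁ : iU ⊣ iS) (adj₂ : iS ⊣ iE) (adj₃ : jL ⊣ jU) (adj₄ : jU ⊣ jR)
    (hg : GluingCond iS jU iU iE jL jR adj₁ adj₂ adj₃ adj₄)
    (tC : TStructure C) (tD : TStructure D) (tE : TStructure E)
    (hglued : GluedTS jU iU iE tC tD tE) :
    (∀ Y : D, (tD.le 0 Y → tC.le 0 (iS.obj Y)) ∧ (tD.ge 0 Y → tC.ge 0 (iS.obj Y))) ∧
    (∀ X : C, (tC.le 0 X → tE.le 0 (jU.obj X)) ∧ (tC.ge 0 X → tE.ge 0 (jU.obj X))) ∧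
    (∀ Y : E, tE.le 0 Y → tC.le 0 (jL.obj Y)) ∧
    (∀ X : C, tC.le 0 X → tD.le 0 (iU.obj X)) ∧
    (∀ Y : E, tE.ge 0 Y → tC.ge 0 (jR.obj Y)) ∧
    (∀ X : C, tC.ge 0 X → tD.ge 0 (iE.obj X)) ∧
    (∀ t' : TStructure C,
      (∀ Y : D, (tD.le 0 Y → t'.le 0 (iS.obj Y)) ∧ (tD.ge 0 Y → t'.ge 0 (iS.obj Y))) →
      (∀ X : C, (t'.le 0 X → tE.le 0 (jU.obj X)) ∧ (t'.ge 0 X → tE.ge 0 (jU.obj X))) →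
      ∀ (n : ℤ) (X : C), (t'.le n X ↔ tC.le n X) ∧ (t'.ge n X ↔ tC.ge n X)) := by
  have hzero : ∀ Y : D, IsZero (jU.obj (iS.obj Y)) := fun Y =>
    (hg.ker_jU _).2 ⟨Y, ⟨Iso.refl _⟩⟩
  refine ⟨fun Y => ⟨fun hY => ?_, fun hY => ?_⟩,
    fun X => ⟨fun hX => ((hglued X).1.1 hX).1, fun hX => ((hglued X).2.1 hX).1⟩,
    fun Y hY => ?_, fun X hX => ((hglued X).1.1 hX).2, fun Y hY => ?_,
    fun X hX => ((hglued X).2.1 hX).2, fun t' hi hj n X => ?_⟩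
  · haveI := hg.iso₁ Y
    exact (hglued _).1.2 ⟨le_of_isZero tE 0 (hzero Y),
      (tD.le 0).prop_of_iso (asIso (adj₁.counit.app Y)).symm hY⟩
  · haveI := hg.iso₂ Y
    exact (hglued _).2.2 ⟨ge_of_isZero tE 0 (hzero Y),
      (tD.ge 0).prop_of_iso (asIso (adj₂.unit.app Y)) hY⟩
  · haveI := hg.iso₃ Y
    exact (hglued _).1.2 ⟨(tE.le 0).prop_of_iso (asIso (adj₃.unit.app Y)) hY,
      le_of_isZero tD 0 (hg.vanish₁ Y)⟩
  · haveI := hg.iso₄ Y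
    exact (hglued _).2.2 ⟨(tE.ge 0).prop_of_iso (asIso (adj₄.counit.app Y)).symm hY,
      ge_of_isZero tD 0 (hg.vanish₂ Y)⟩
  · refine tstructure_eq_of_le tC t' (fun X hX => ?_) (fun X hX => ?_) n X
    · refine (hglued X).1.2 ⟨(hj X).1 hX, (le_iff_orth tD 0 1 (by lia) _).2 fun Y f hY => ?_⟩
      have hY' := map_ge iS tD t' (fun Y => (hi Y).2) 1 Y hY
      apply (adj₁.homEquiv X Y).injective
      rw [(le_iff_orth t' 0 1 (by lia) _).1 hX _ (adj₁.homEquiv X Y f) hY']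
      simp [Adjunction.homEquiv_unit]
    · refine (hglued X).2.2 ⟨(hj X).2 hX, (ge_iff_orth tD (-1) 0 (by lia) _).2 fun Y f hY => ?_⟩
      have hY' := map_le iS tD t' (fun Y => (hi Y).1) (-1) Y hY
      apply (adj₂.homEquiv Y X).symm.injective
      rw [(ge_iff_orth t' (-1) 0 (by lia) _).1 hX _ ((adj₂.homEquiv Y X).symm f) hY']
      simp [Adjunction.homEquiv_counit]

end PaperGluing
end

section
/- Let (C, D, E, i_*, j^*, i^*, i^!, j_!, j_*) be gluing data, and assume C, D, E are endowed with weight structures w_C, w_D, w_E such that i_* and j^* are weight-exact (compatible weight structures). Then j_! and i^* are left weight-exact, j_* and i^! are right weight-exact; moreover C_{w_C≥0} = {M ∈ Obj C : i^!M ∈ D_{w_D≥0} and j^*M ∈ E_{w_E≥0}} and C_{w_C≤0} = {M ∈ Obj C : i^*M ∈ D_{w_D≤0} and j^*M ∈ E_{w_E≤0}}. -/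
namespace PaperGluing

open CategoryTheory CategoryTheory.Limits CategoryTheory.Pretriangulated CategoryTheory.Triangulated

universe v v₂ v₃ v₄ u u₂ u₃ u₄

variable {C : Type u} {D : Type u₂} {E : Type u₃}
  [Category.{v} C] [Category.{v₂} D] [Category.{v₃} E]
  [HasZeroObject C] [HasZeroObject D] [HasZeroObject E]
  [Preadditive C] [Preadditive D] [Preadditive E]
  [HasShift C ℤ] [HasShift D ℤ] [HasShift E ℤ]
  [∀ n : ℤ, (shiftFunctor C n).Additive] [∀ n : ℤ, (shiftFunctor D n).Additive]
  [∀ n : ℤ, (shiftFunctor E n).Additive]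
  [Pretriangulated C] [Pretriangulated D] [Pretriangulated E]

section GenericWS

variable (A : Type u₄) [Category.{v₄} A] [HasZeroObject A] [Preadditive A] [HasShift A ℤ]
  [∀ n : ℤ, (shiftFunctor A n).Additive] [Pretriangulated A]

/-- The pair of classes `(le, ge)`, playing the roles of `A_{w≤0}` and `A_{w≥0}`,
defines a weight structure on the triangulated category `A`. -/
structure IsWeightStructure (le ge : Set A) : Prop where
  retract_le : ∀ ⦃X Y : A⦄ (s : X ⟶ Y) (r : Y ⟶ X), s ≫ r = 𝟙 X → Y ∈ le → X ∈ le
  retract_ge : ∀ ⦃X Y : A⦄ (s : X ⟶ Y) (r : Y ⟶ X), s ≫ r = 𝟙 X → Y ∈ ge → X ∈ ge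
  zero_le : ∀ ⦃X : A⦄, IsZero X → X ∈ le
  zero_ge : ∀ ⦃X : A⦄, IsZero X → X ∈ ge
  sum_le : ∀ ⦃X Y : A⦄ (b : BinaryBicone X Y), b.IsBilimit → X ∈ le → Y ∈ le → b.pt ∈ le
  sum_ge : ∀ ⦃X Y : A⦄ (b : BinaryBicone X Y), b.IsBilimit → X ∈ ge → Y ∈ ge → b.pt ∈ ge
  shift_le : ∀ ⦃X : A⦄, X ∈ le → (X⟦(-1 : ℤ)⟧) ∈ le
  shift_ge : ∀ ⦃X : A⦄, X ∈ ge → (X⟦(1 : ℤ)⟧) ∈ ge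
  orthogonal : ∀ ⦃X Y : A⦄, X ∈ le → Y ∈ ge → ∀ f : X ⟶ (Y⟦(1 : ℤ)⟧), f = 0
  exists_decomp : ∀ M : A, ∃ (B X : A) (f : B ⟶ M) (g : M ⟶ X) (h : X ⟶ B⟦(1 : ℤ)⟧),
    B ∈ le ∧ (X⟦(-1 : ℤ)⟧) ∈ ge ∧ (Triangle.mk f g h ∈ distTriang A)

end GenericWS

section Helpers

variable {A : Type u₄} [Category.{v₄} A] [HasZeroObject A] [Preadditive A] [HasShift A ℤ]
  [∀ n : ℤ, (shiftFunctor A n).Additive] [Pretriangulated A]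

theorem mem_le_of_orth {le ge : Set A} (h : IsWeightStructure A le ge) {X : A}
    (hX : ∀ Y ∈ ge, ∀ f : X ⟶ Y⟦(1 : ℤ)⟧, f = 0) : X ∈ le := by
  obtain ⟨B, Z, f, g, k, hB, hZ, hT⟩ := h.exists_decomp X
  have e : Z ≅ (Z⟦(-1 : ℤ)⟧)⟦(1 : ℤ)⟧ := (shiftNegShift Z (1 : ℤ)).symm
  have hg : g = 0 := by
    rw [← cancel_mono e.hom, zero_comp]
    exact hX _ hZ _
  obtain ⟨s, hs⟩ := Triangle.coyoneda_exact₂ _ hT (𝟙 X) ((Category.id_comp g).trans hg)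
  exact h.retract_le s f hs.symm hB

theorem mem_ge_of_orth {le ge : Set A} (h : IsWeightStructure A le ge) {Y : A}
    (hY : ∀ X ∈ le, ∀ f : X ⟶ Y⟦(1 : ℤ)⟧, f = 0) : Y ∈ ge := by
  obtain ⟨B, Z, f, g, k, hB, hZ, hT⟩ := h.exists_decomp (Y⟦(1 : ℤ)⟧)
  have hf : f = 0 := hY _ hB f
  obtain ⟨r, hr⟩ := Triangle.yoneda_exact₂ _ hT (𝟙 (Y⟦(1 : ℤ)⟧))
    ((Category.comp_id f).trans hf)
  have e : (Y⟦(1 : ℤ)⟧)⟦(-1 : ℤ)⟧ ≅ Y := shiftShiftNeg Y (1 : ℤ)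
  change Z ⟶ Y⟦(1 : ℤ)⟧ at r
  have hgr : g ≫ r = 𝟙 _ := hr.symm
  refine h.retract_ge (e.inv ≫ (shiftFunctor A (-1 : ℤ)).map g) ((shiftFunctor A (-1 : ℤ)).map r ≫ e.hom) ?_ hZ
  rw [Category.assoc, ← Functor.map_comp_assoc, hgr]
  simp

theorem ext_le {le ge : Set A} (h : IsWeightStructure A le ge) {T : Triangle A}
    (hT : T ∈ distTriang A) (h₁ : T.obj₁ ∈ le) (h₃ : T.obj₃ ∈ le) : T.obj₂ ∈ le := by
  refine mem_le_of_orth h fun Y hY f => ?_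
  obtain ⟨g, rfl⟩ := Triangle.yoneda_exact₂ _ hT f (h.orthogonal h₁ hY _)
  rw [h.orthogonal h₃ hY g, comp_zero]

theorem ext_ge {le ge : Set A} (h : IsWeightStructure A le ge) {T : Triangle A}
    (hT : T ∈ distTriang A) (h₁ : T.obj₁ ∈ ge) (h₃ : T.obj₃ ∈ ge) : T.obj₂ ∈ ge := by
  refine mem_ge_of_orth h fun X hX f => ?_
  obtain ⟨g, hg⟩ := Triangle.coyoneda_exact₂ _ (Triangle.shift_distinguished T hT 1) f
    (h.orthogonal hX h₃ _)
  rw [hg, h.orthogonal hX h₁ g]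
  exact zero_comp

end Helpers

theorem left_exact_of_adj {L : C ⥤ D} {R : D ⥤ C} (adj : L ⊣ R) [R.CommShift ℤ]
    {lC gC : Set C} {lD gD : Set D} (hC : IsWeightStructure C lC gC)
    (hD : IsWeightStructure D lD gD) (hR : ∀ Y ∈ gD, R.obj Y ∈ gC) (X : C) (hX : X ∈ lC) :
    L.obj X ∈ lD := by
  refine mem_le_of_orth hD fun Y hY f => ?_
  have key : ∀ f : L.obj X ⟶ Y⟦(1 : ℤ)⟧,
      adj.homEquiv _ _ f ≫ (R.commShiftIso (1 : ℤ)).hom.app Y = 0 :=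
    fun f => hC.orthogonal hX (hR Y hY) _
  apply (adj.homEquiv _ _).injective
  rw [← cancel_mono ((R.commShiftIso (1 : ℤ)).hom.app Y), key f, key 0]

theorem right_exact_of_adj {L : C ⥤ D} {R : D ⥤ C} (adj : L ⊣ R) [R.CommShift ℤ]
    {lC gC : Set C} {lD gD : Set D} (hC : IsWeightStructure C lC gC)
    (hD : IsWeightStructure D lD gD) (hL : ∀ X ∈ lC, L.obj X ∈ lD) (Y : D) (hY : Y ∈ gD) :
    R.obj Y ∈ gC := by
  refine mem_ge_of_orth hC fun X hX f => ?_
  have key : ∀ f : X ⟶ (R.obj Y)⟦(1 : ℤ)⟧,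
      (adj.homEquiv _ _).symm (f ≫ (R.commShiftIso (1 : ℤ)).inv.app Y) = 0 :=
    fun f => hD.orthogonal (hL X hX) hY _
  rw [← cancel_mono ((R.commShiftIso (1 : ℤ)).inv.app Y)]
  apply (adj.homEquiv _ _).symm.injective
  rw [key f, key 0]

/-- Given gluing data with compatible weight structures
`w_C, w_D, w_E` (i.e. `i_*` and `j^*` are weight-exact): `j_!` and `i^*` are
left weight-exact, `j_*` and `i^!` are right weight-exact, and
`C_{w≥0} = {M : i^!M ∈ D_{w≥0} ∧ j^*M ∈ E_{w≥0}}`,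
`C_{w≤0} = {M : i^*M ∈ D_{w≤0} ∧ j^*M ∈ E_{w≤0}}`. -/
theorem statement16
    (iS : D ⥤ C) (jU : C ⥤ E) (iU iE : C ⥤ D) (jL jR : E ⥤ C)
    [iS.CommShift ℤ] [jU.CommShift ℤ] [iU.CommShift ℤ] [iE.CommShift ℤ]
    [jL.CommShift ℤ] [jR.CommShift ℤ]
    [iS.IsTriangulated] [jU.IsTriangulated] [iU.IsTriangulated]
    [iE.IsTriangulated] [jL.IsTriangulated] [jR.IsTriangulated]
    (adj₁ : iU ⊣ iS) (adj₂ : iS ⊣ iE) (adj₃ : jL ⊣ jU) (adj₄ : jU ⊣ jR)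
    (hg : GluingCond iS jU iU iE jL jR adj₁ adj₂ adj₃ adj₄)
    (wCle wCge : Set C) (wDle wDge : Set D) (wEle wEge : Set E)
    (hwC : IsWeightStructure C wCle wCge) (hwD : IsWeightStructure D wDle wDge)
    (hwE : IsWeightStructure E wEle wEge)
    (hiS : ∀ Y : D, (Y ∈ wDle → iS.obj Y ∈ wCle) ∧ (Y ∈ wDge → iS.obj Y ∈ wCge))
    (hjU : ∀ X : C, (X ∈ wCle → jU.obj X ∈ wEle) ∧ (X ∈ wCge → jU.obj X ∈ wEge)) :
    (∀ Y : E, Y ∈ wEle → jL.obj Y ∈ wCle) ∧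
    (∀ X : C, X ∈ wCle → iU.obj X ∈ wDle) ∧
    (∀ Y : E, Y ∈ wEge → jR.obj Y ∈ wCge) ∧
    (∀ X : C, X ∈ wCge → iE.obj X ∈ wDge) ∧
    (∀ M : C, M ∈ wCge ↔ (iE.obj M ∈ wDge ∧ jU.obj M ∈ wEge)) ∧
    (∀ M : C, M ∈ wCle ↔ (iU.obj M ∈ wDle ∧ jU.obj M ∈ wEle)) := by
  have a := left_exact_of_adj adj₃ hwE hwC (fun X => (hjU X).2)
  have b := left_exact_of_adj adj₁ hwC hwD (fun X => (hiS X).2)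
  have c := right_exact_of_adj adj₄ hwC hwE (fun X => (hjU X).1)
  have d := right_exact_of_adj adj₂ hwD hwC (fun X => (hiS X).1)
  refine ⟨a, b, c, d, fun M => ⟨fun h => ⟨d M h, (hjU M).2 h⟩, fun h => ?_⟩,
    fun M => ⟨fun h => ⟨b M h, (hjU M).1 h⟩, fun h => ?_⟩⟩
  · obtain ⟨δ, hδ⟩ := hg.tri₂ M
    exact ext_ge hwC hδ ((hiS _).2 h.1) (c _ h.2)
  · obtain ⟨δ, hδ⟩ := hg.tri₁ M
    exact ext_le hwC hδ (a _ h.2) ((hiS _).1 h.1)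

end PaperGluing
end

section
/- Let (C, D, E, i_*, j^*, i^*, i^!, j_!, j_*) be gluing data endowed with compatible t-structures t_C, t_D, t_E, and let X ∈ C^{t_C=0}. Then there exist objects K₁, K₂ of the heart of t_C lying in i_*(D^{t_D=0}) and an object Y of the heart of t_C together with short exact sequences in the heart of t_C: 0 → K₁ → X → Y → 0 and 0 → j_{!*}(j^*X) → Y → K₂ → 0; in other words, X is obtained from j_{!*}j^*X via two extensions by objects of i_*(D^{t_D=0}). -/
namespace PaperGluing

open CategoryTheory CategoryTheory.Limits CategoryTheory.Pretriangulated CategoryTheory.Triangulated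

universe v v₂ v₃ v₄ u u₂ u₃ u₄

variable {C : Type u} {D : Type u₂} {E : Type u₃}
  [Category.{v} C] [Category.{v₂} D] [Category.{v₃} E]
  [HasZeroObject C] [HasZeroObject D] [HasZeroObject E]
  [Preadditive C] [Preadditive D] [Preadditive E]
  [HasShift C ℤ] [HasShift D ℤ] [HasShift E ℤ]
  [∀ n : ℤ, (shiftFunctor C n).Additive] [∀ n : ℤ, (shiftFunctor D n).Additive]
  [∀ n : ℤ, (shiftFunctor E n).Additive]
  [Pretriangulated C] [Pretriangulated D] [Pretriangulated E]

section Helpers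

lemma shortExact_aux {A : Type*} [Category* A] [Preadditive A] {Z : A} (hZ : IsZero Z)
    {K X Y : A} (a : K ⟶ X) (b : X ⟶ Y) (w : a ≫ b = 0) [Mono a] [Epi b]
    (hl : ∀ (W : A) (g : W ⟶ X), g ≫ b = 0 → ∃ g' : W ⟶ K, g' ≫ a = g)
    (hr : ∀ (W : A) (g : X ⟶ W), a ≫ g = 0 → ∃ g' : Y ⟶ W, b ≫ g' = g) :
    (ShortComplex.mk a b w).ShortExact := by
  let kl : IsLimit (KernelFork.ofι a w) :=
    KernelFork.IsLimit.ofι' a w (fun g hg => ⟨(hl _ g hg).choose, (hl _ g hg).choose_spec⟩)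
  let kr : IsColimit (CokernelCofork.ofπ b w) :=
    CokernelCofork.IsColimit.ofπ' b w (fun g hg => ⟨(hr _ g hg).choose, (hr _ g hg).choose_spec⟩)
  have el : kl.lift (KernelFork.ofι a w) = 𝟙 K := by
    apply Fork.IsLimit.hom_ext kl
    rw [Fork.IsLimit.lift_ι]
    exact (Category.id_comp a).symm
  have er : kr.desc (CokernelCofork.ofπ b w) = 𝟙 Y := by
    apply Cofork.IsColimit.hom_ext kr
    rw [Cofork.IsColimit.π_desc]
    exact (Category.comp_id b).symm
  refine ShortComplex.ShortExact.mk' ⟨⟨⟨⟨K, Z, a, 0, w, kl, comp_zero, ?_⟩,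
    ⟨Y, Z, b, 0, w, kr, zero_comp, ?_⟩, Iso.refl _, ?_⟩, hZ⟩⟩ ‹_› ‹_›
  · haveI : Epi (0 : K ⟶ Z) := ⟨fun _ _ _ => hZ.eq_of_src _ _⟩
    refine CokernelCofork.IsColimit.ofπ' _ _ (fun g hg => ⟨0, ?_⟩)
    have h : kl.lift (KernelFork.ofι a w) ≫ g = 0 := hg
    rw [el] at h
    have h' : g = 0 := (Category.id_comp g).symm.trans h
    exact zero_comp.trans h'.symm
  · haveI : Mono (0 : Z ⟶ Y) := ⟨fun _ _ _ => hZ.eq_of_tgt _ _⟩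
    refine KernelFork.IsLimit.ofι' _ _ (fun g hg => ⟨0, ?_⟩)
    have h : g ≫ kr.desc (CokernelCofork.ofπ b w) = 0 := hg
    rw [er] at h
    have h' : g = 0 := (Category.comp_id g).symm.trans h
    exact comp_zero.trans h'.symm
  · simp [w]

variable {A : Type u₄} [Category.{v₄} A] [HasZeroObject A] [Preadditive A] [HasShift A ℤ]
  [∀ n : ℤ, (shiftFunctor A n).Additive] [Pretriangulated A]

lemma tri_y2 {X Y Z : A} {f : X ⟶ Y} {g : Y ⟶ Z} {h : Z ⟶ X⟦(1 : ℤ)⟧}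
    (hT : Triangle.mk f g h ∈ distTriang A) {W : A} (k : Y ⟶ W) (hk : f ≫ k = 0) :
    ∃ l : Z ⟶ W, k = g ≫ l :=
  Triangle.yoneda_exact₂ _ hT k hk

lemma tri_y3 {X Y Z : A} {f : X ⟶ Y} {g : Y ⟶ Z} {h : Z ⟶ X⟦(1 : ℤ)⟧}
    (hT : Triangle.mk f g h ∈ distTriang A) {W : A} (k : Z ⟶ W) (hk : g ≫ k = 0) :
    ∃ l : X⟦(1 : ℤ)⟧ ⟶ W, k = h ≫ l :=
  Triangle.yoneda_exact₃ _ hT k hk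

lemma tri_c2 {X Y Z : A} {f : X ⟶ Y} {g : Y ⟶ Z} {h : Z ⟶ X⟦(1 : ℤ)⟧}
    (hT : Triangle.mk f g h ∈ distTriang A) {W : A} (k : W ⟶ Y) (hk : k ≫ g = 0) :
    ∃ l : W ⟶ X, k = l ≫ f :=
  Triangle.coyoneda_exact₂ _ hT k hk

lemma tri_c1 {X Y Z : A} {f : X ⟶ Y} {g : Y ⟶ Z} {h : Z ⟶ X⟦(1 : ℤ)⟧}
    (hT : Triangle.mk f g h ∈ distTriang A) {W : A} (k : W ⟶ X) (hk : k ≫ f = 0) :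
    ∃ (l : W ⟶ Z⟦(-1 : ℤ)⟧) (m : Z⟦(-1 : ℤ)⟧ ⟶ X), k = l ≫ m :=
  let ⟨l, hl⟩ := Triangle.coyoneda_exact₂ _ (inv_rot_of_distTriang _ hT) k hk
  ⟨l, _, hl⟩

lemma isLE₃ (t : TStructure A) {X Y Z : A} {f : X ⟶ Y} {g : Y ⟶ Z} {h : Z ⟶ X⟦(1 : ℤ)⟧}
    (hT : Triangle.mk f g h ∈ distTriang A) (n : ℤ)
    (h₁ : t.IsLE X (n + 1)) (h₂ : t.IsLE Y n) : t.IsLE Z n :=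
  t.isLE₂ _ (rot_of_distTriang _ hT) n h₂ (t.isLE_shift X (n + 1) 1 n (by lia))

lemma isGE₁ (t : TStructure A) {X Y Z : A} {f : X ⟶ Y} {g : Y ⟶ Z} {h : Z ⟶ X⟦(1 : ℤ)⟧}
    (hT : Triangle.mk f g h ∈ distTriang A) (n : ℤ)
    (h₂ : t.IsGE Y n) (h₃ : t.IsGE Z (n - 1)) : t.IsGE X n :=
  t.isGE₂ _ (inv_rot_of_distTriang _ hT) n (t.isGE_shift Z (n - 1) (-1) n (by lia)) h₂

lemma heart_isLE {t : TStructure A} (X : THeart A t) : t.IsLE X.obj 0 := ⟨X.property.1⟩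

lemma heart_isGE {t : TStructure A} (X : THeart A t) : t.IsGE X.obj 0 := ⟨X.property.2⟩

lemma heart_hom_eq_zero_iff {t : TStructure A} {X Y : THeart A t} (f : X ⟶ Y) :
    f = 0 ↔ f.hom = 0 :=
  ⟨fun h => by rw [h]; rfl, fun h => ObjectProperty.hom_ext _ h⟩

lemma heart_isZero {t : TStructure A} {X : A} (hX : IsZero X) (h : X ∈ heartSet A t) :
    IsZero (⟨X, h⟩ : THeart A t) := by
  rw [IsZero.iff_id_eq_zero, heart_hom_eq_zero_iff]
  exact hX.eq_of_src _ _

lemma shortExact_of_triangle (t : TStructure A) {K X Y : THeart A t}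
    (a : K.obj ⟶ X.obj) (b : X.obj ⟶ Y.obj) (δ : Y.obj ⟶ K.obj⟦(1 : ℤ)⟧)
    (hT : Triangle.mk a b δ ∈ distTriang A) :
    ∃ w : (ObjectProperty.homMk a : K ⟶ X) ≫ (ObjectProperty.homMk b : X ⟶ Y) = 0,
      (ShortComplex.mk _ _ w).ShortExact := by
  have w₀ : a ≫ b = 0 := comp_distTriang_mor_zero₁₂ _ hT
  have w : (ObjectProperty.homMk a : K ⟶ X) ≫ (ObjectProperty.homMk b : X ⟶ Y) = 0 :=
    (heart_hom_eq_zero_iff _).2 w₀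
  refine ⟨w, ?_⟩
  obtain ⟨Z, hZ⟩ : ∃ Z : A, IsZero Z := HasZeroObject.zero
  have hZ := heart_isZero (t := t) hZ ⟨(t.isLE_of_isZero hZ 0).le, (t.isGE_of_isZero hZ 0).ge⟩
  have hm : Mono (ObjectProperty.homMk a : K ⟶ X) := by
    refine Preadditive.mono_of_cancel_zero _ (fun {W} g hg => ?_)
    rw [heart_hom_eq_zero_iff] at hg ⊢
    obtain ⟨g', m, hg'⟩ := tri_c1 hT g.hom hg
    have h1 : t.IsGE (Y.obj⟦(-1 : ℤ)⟧) 1 :=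
      have := heart_isGE Y
      t.isGE_shift _ 0 (-1) 1
    rw [hg', t.zero_of_isLE_of_isGE g' 0 1 (by lia) (heart_isLE W) h1, zero_comp]
  have he : Epi (ObjectProperty.homMk b : X ⟶ Y) := by
    refine Preadditive.epi_of_cancel_zero _ (fun {W} g hg => ?_)
    rw [heart_hom_eq_zero_iff] at hg ⊢
    obtain ⟨g', hg'⟩ := tri_y3 hT g.hom hg
    have h1 : t.IsLE (K.obj⟦(1 : ℤ)⟧) (-1) :=
      have := heart_isLE K
      t.isLE_shift _ 0 1 (-1)
    rw [hg', t.zero_of_isLE_of_isGE g' (-1) 0 (by lia) h1 (heart_isGE W), comp_zero]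
  refine shortExact_aux hZ _ _ w (fun W g hg => ?_) (fun W g hg => ?_)
  · rw [heart_hom_eq_zero_iff] at hg
    obtain ⟨g', hg'⟩ := tri_c2 hT g.hom hg
    exact ⟨ObjectProperty.homMk g', ObjectProperty.hom_ext _ hg'.symm⟩
  · rw [heart_hom_eq_zero_iff] at hg
    obtain ⟨g', hg'⟩ := tri_y2 hT g.hom hg
    exact ⟨ObjectProperty.homMk g', ObjectProperty.hom_ext _ hg'.symm⟩

lemma heart_isIso (t : TStructure A) {X Y : THeart A t} (f : X ⟶ Y) [Mono f] [Epi f] :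
    IsIso f := by
  have := heart_isLE X
  have := heart_isLE Y
  have := heart_isGE X
  have := heart_isGE Y
  obtain ⟨N, u, v, hT⟩ := distinguished_cocone_triangle₁ f.hom
  have hT2 : Triangle.mk f.hom v (-u⟦(1 : ℤ)⟧') ∈ distTriang A := rot_of_distTriang _ hT
  have hX1 : t.IsLE (X.obj⟦(1 : ℤ)⟧) (-1) := t.isLE_shift _ 0 1 (-1)
  have hY1 : t.IsGE (Y.obj⟦(-1 : ℤ)⟧) 1 := t.isGE_shift _ 0 (-1) 1
  have hN0 : t.IsLE (N⟦(1 : ℤ)⟧) 0 := isLE₃ t hT2 0 (t.isLE_of_le X.obj 0 _) ‹_›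
  have hN1 : t.IsGE N 0 := isGE₁ t hT 0 ‹_› (t.isGE_of_ge Y.obj _ 0)
  have hNle : t.IsLE (N⟦(1 : ℤ)⟧) (-1) := by
    rw [t.isLE_iff_orthogonal (-1) 0 (by lia)]
    intro W q hW
    obtain ⟨P, Q, hP, hQ, p, r, s, hT'⟩ := t.exists_triangle W 0 1 (by lia)
    have hP : t.IsLE P 0 := ⟨hP⟩
    have hQ : t.IsGE Q 1 := ⟨hQ⟩
    have hP' : t.IsGE P 0 := isGE₁ t hT' 0 hW (t.isGE_of_ge Q _ 1)
    obtain ⟨q', hq'⟩ := tri_c2 hT' q (t.zero _ 0 1)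
    have hz : v ≫ q' = 0 := by
      let k : Y ⟶ (⟨P, hP.le, hP'.ge⟩ : THeart A t) := ObjectProperty.homMk (v ≫ q')
      have h0 : f.hom ≫ v = 0 := comp_distTriang_mor_zero₁₂ _ hT2
      have h1 : f.hom ≫ v ≫ q' = 0 := by rw [← Category.assoc, h0, zero_comp]
      have hk : f ≫ k = 0 := (heart_hom_eq_zero_iff _).2 h1
      have hk' : k = 0 := by rwa [← cancel_epi f, comp_zero]
      exact (heart_hom_eq_zero_iff k).1 hk'
    obtain ⟨q'', hq''⟩ := tri_y3 hT2 q' hz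
    have : q'' = 0 := t.zero_of_isLE_of_isGE q'' (-1) 0 (by lia) hX1 hP'
    rw [hq', hq'', this, comp_zero, zero_comp]
  have hNge : t.IsGE N 1 := by
    rw [t.isGE_iff_orthogonal 0 1 (by lia)]
    intro W q hW
    obtain ⟨P, Q, hP, hQ, p, r, s, hT'⟩ := t.exists_triangle W (-1) 0 (by lia)
    have hP : t.IsLE P (-1) := ⟨hP⟩
    have hQ : t.IsGE Q 0 := ⟨hQ⟩
    have hQ' : t.IsLE Q 0 := isLE₃ t hT' 0 (t.isLE_of_le P (-1) _) hW
    obtain ⟨q', hq'⟩ := tri_y2 hT' q (t.zero_of_isLE_of_isGE _ (-1) 0 (by lia) hP hN1)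
    have hz : q' ≫ u = 0 := by
      let k : (⟨Q, hQ'.le, hQ.ge⟩ : THeart A t) ⟶ X := ObjectProperty.homMk (q' ≫ u)
      have h0 : u ≫ f.hom = 0 := comp_distTriang_mor_zero₁₂ _ hT
      have h1 : (q' ≫ u) ≫ f.hom = 0 := by rw [Category.assoc, h0, comp_zero]
      have hk : k ≫ f = 0 := (heart_hom_eq_zero_iff _).2 h1
      have hk' : k = 0 := by rwa [← cancel_mono f, zero_comp]
      exact (heart_hom_eq_zero_iff k).1 hk'
    obtain ⟨q'', m, hq''⟩ := tri_c1 hT q' hz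
    have : q'' = 0 := t.zero_of_isLE_of_isGE q'' 0 1 (by lia) hQ' hY1
    rw [hq', hq'', this, zero_comp, comp_zero]
  have hNge' : t.IsGE (N⟦(1 : ℤ)⟧) 0 := t.isGE_shift N 1 1 0
  have hN : IsZero (N⟦(1 : ℤ)⟧) := t.isZero _ (-1) 0
  have hf : IsIso f.hom := (Triangle.isZero₃_iff_isIso₁ _ hT2).1 hN
  have hf' : IsIso ((heartIncl A t).map f) := hf
  exact isIso_of_fully_faithful (heartIncl A t) f

lemma image_iso_of_middle {t : TStructure A} (τ : TruncData A t) [HasImages (THeart A t)]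
    {L R : A} (M : THeart A t) (hL : t.IsLE L 0) (hR : t.IsGE R 0)
    (a : L ⟶ M.obj) (b : M.obj ⟶ R)
    (ha : ∀ (W : A), W ∈ heartSet A t → ∀ g : M.obj ⟶ W, a ≫ g = 0 → g = 0)
    (hb : ∀ (W : A), W ∈ heartSet A t → ∀ g : W ⟶ M.obj, g ≫ b = 0 → g = 0) :
    Nonempty (image (τ.H₀.map (a ≫ b)) ≅ M) := by
  obtain ⟨e, he, nat1⟩ : ∃ e : ∀ Z : A, τ.truncLE.obj Z ⟶ Z,
      (∀ W X : A, t.le 0 W → Function.Bijective (fun f : W ⟶ τ.truncLE.obj X => f ≫ e X)) ∧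
      ∀ {U V : A} (f : U ⟶ V), τ.truncLE.map f ≫ e V = e U ≫ f :=
    ⟨fun Z => τ.εLE.app Z, τ.le_univ, fun f => τ.εLE.naturality f⟩
  obtain ⟨n, hn, nat2⟩ : ∃ n : ∀ Z : A, Z ⟶ τ.truncGE.obj Z,
      (∀ X W : A, t.ge 0 W → Function.Bijective (fun f : τ.truncGE.obj X ⟶ W => n X ≫ f)) ∧
      ∀ {U V : A} (f : U ⟶ V), f ≫ n V = n U ≫ τ.truncGE.map f :=
    ⟨fun Z => τ.ηGE.app Z, τ.ge_univ, fun f => τ.ηGE.naturality f⟩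
  have hε : ∀ Z : A, t.le 0 Z → IsIso (e Z) := by
    intro Z hZ
    obtain ⟨s, hs⟩ := (he Z Z hZ).2 (𝟙 Z)
    have hs : s ≫ e Z = 𝟙 Z := hs
    refine ⟨s, (he _ Z (τ.mem_le Z)).1 ?_, hs⟩
    change (e Z ≫ s) ≫ e Z = 𝟙 _ ≫ e Z
    rw [Category.assoc, hs, Category.id_comp, Category.comp_id]
  have hη : ∀ Z : A, t.ge 0 Z → IsIso (n Z) := by
    intro Z hZ
    obtain ⟨s, hs⟩ := (hn Z Z hZ).2 (𝟙 Z)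
    have hs : n Z ≫ s = 𝟙 Z := hs
    refine ⟨s, hs, (hn Z _ (τ.mem_ge Z)).1 ?_⟩
    change n Z ≫ s ≫ n Z = n Z ≫ 𝟙 _
    rw [← Category.assoc, hs, Category.comp_id, Category.id_comp]
  have hge : ∀ Z : A, t.ge 0 Z → t.ge 0 (τ.truncLE.obj Z) := by
    intro Z hZ
    have hZ : t.IsGE Z 0 := ⟨hZ⟩
    rw [TStructure.ge_iff_isGE, t.isGE_iff_orthogonal (-1) 0 (by lia)]
    intro W f hW
    apply (he W Z (t.isLE_of_le W (-1) 0).le).1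
    change f ≫ e Z = 0 ≫ e Z
    rw [zero_comp]
    exact t.zero _ (-1) 0
  have iL := hε _ hL.le
  have iM := hε _ M.property.1
  have jM := hη _ (hge _ M.property.2)
  have jR := hη _ (hge _ hR.ge)
  have key1 : ∀ (W : A), W ∈ heartSet A t → ∀ g : τ.truncGE.obj (τ.truncLE.obj M.obj) ⟶ W,
      τ.truncGE.map (τ.truncLE.map a) ≫ g = 0 → g = 0 := by
    intro W hW g hg
    have h1 : a ≫ inv (e M.obj) ≫ n (τ.truncLE.obj M.obj) ≫ g = 0 := by
      rw [← cancel_epi (e L), comp_zero, ← Category.assoc, ← nat1, Category.assoc,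
        IsIso.hom_inv_id_assoc, ← Category.assoc, nat2, Category.assoc, hg, comp_zero]
    have h2 := ha _ hW _ h1
    rw [← cancel_epi (n (τ.truncLE.obj M.obj)), ← cancel_epi (inv (e M.obj)), h2]
    simp
  have key2 : ∀ (W : A), W ∈ heartSet A t → ∀ g : W ⟶ τ.truncGE.obj (τ.truncLE.obj M.obj),
      g ≫ τ.truncGE.map (τ.truncLE.map b) = 0 → g = 0 := by
    intro W hW g hg
    have h0 : g ≫ inv (n (τ.truncLE.obj M.obj)) ≫ τ.truncLE.map b = 0 := by
      rw [← cancel_mono (n (τ.truncLE.obj R)), zero_comp, Category.assoc,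
        Category.assoc, nat2, IsIso.inv_hom_id_assoc, hg]
    have h1 : (g ≫ inv (n (τ.truncLE.obj M.obj)) ≫ e M.obj) ≫ b = 0 := by
      rw [Category.assoc, Category.assoc, ← nat1, ← Category.assoc, ← Category.assoc,
        Category.assoc g, h0, zero_comp]
    have h2 := hb _ hW _ h1
    rw [← cancel_mono (inv (n (τ.truncLE.obj M.obj))), ← cancel_mono (e M.obj),
      Category.assoc, h2]
    simp
  have hepi : Epi (τ.H₀.map a) := by
    refine Preadditive.epi_of_cancel_zero _ (fun {W} g hg => ?_)
    rw [heart_hom_eq_zero_iff] at hg ⊢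
    exact key1 _ W.property g.hom hg
  have hmono : Mono (τ.H₀.map b) := by
    refine Preadditive.mono_of_cancel_zero _ (fun {W} g hg => ?_)
    rw [heart_hom_eq_zero_iff] at hg ⊢
    exact key2 _ W.property g.hom hg
  let F : MonoFactorisation (τ.H₀.map (a ≫ b)) :=
    { I := τ.H₀.obj M.obj
      m := τ.H₀.map b
      m_mono := hmono
      e := τ.H₀.map a
      fac := (τ.H₀.map_comp a b).symm }
  let i : image (τ.H₀.map (a ≫ b)) ⟶ τ.H₀.obj M.obj := image.lift F
  have hi : i ≫ τ.H₀.map b = image.ι _ := image.lift_fac F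
  have hi' : factorThruImage (τ.H₀.map (a ≫ b)) ≫ i = τ.H₀.map a := by
    rw [← cancel_mono (τ.H₀.map b), Category.assoc, hi, image.fac, τ.H₀.map_comp]
  have : Mono i := mono_of_mono_fac hi
  have : Epi i := epi_of_epi_fac hi'
  have := heart_isIso t i
  exact ⟨asIso i ≪≫ ObjectProperty.isoMk _ (τ.isoHeart M.obj M.property)⟩

lemma cone_iso₃ {X Y Z X' Y' Z' : A} {f : X ⟶ Y} {g : Y ⟶ Z} {h : Z ⟶ X⟦(1 : ℤ)⟧}
    {f' : X' ⟶ Y'} {g' : Y' ⟶ Z'} {h' : Z' ⟶ X'⟦(1 : ℤ)⟧}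
    (hT : Triangle.mk f g h ∈ distTriang A) (hT' : Triangle.mk f' g' h' ∈ distTriang A)
    (e₁ : X ≅ X') (e₂ : Y ≅ Y') (comm : f ≫ e₂.hom = e₁.hom ≫ f') : Nonempty (Z ≅ Z') :=
  ⟨Triangle.π₃.mapIso (isoTriangleOfIso₁₂ _ _ hT hT' e₁ e₂ comm)⟩

lemma cone_iso₁ {X Y Z X' Y' Z' : A} {f : X ⟶ Y} {g : Y ⟶ Z} {h : Z ⟶ X⟦(1 : ℤ)⟧}
    {f' : X' ⟶ Y'} {g' : Y' ⟶ Z'} {h' : Z' ⟶ X'⟦(1 : ℤ)⟧}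
    (hT : Triangle.mk f g h ∈ distTriang A) (hT' : Triangle.mk f' g' h' ∈ distTriang A)
    (e₂ : Y ≅ Y') (e₃ : Z ≅ Z') (comm : g ≫ e₃.hom = e₂.hom ≫ g') : Nonempty (X ≅ X') := by
  obtain ⟨e⟩ := cone_iso₃ (rot_of_distTriang _ hT) (rot_of_distTriang _ hT') e₂ e₃ comm
  exact ⟨(shiftFunctor A (1 : ℤ)).preimageIso e⟩

lemma map_dist {B : Type*} [Category* B] [HasZeroObject B] [Preadditive B] [HasShift B ℤ]
    [∀ n : ℤ, (shiftFunctor B n).Additive] [Pretriangulated B] (F : A ⥤ B) [F.CommShift ℤ]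
    [F.IsTriangulated] {X Y Z : A} {f : X ⟶ Y} {g : Y ⟶ Z} {h : Z ⟶ X⟦(1 : ℤ)⟧}
    (hT : Triangle.mk f g h ∈ distTriang A) :
    ∃ h', Triangle.mk (F.map f) (F.map g) h' ∈ distTriang B :=
  ⟨_, F.map_distinguished _ hT⟩

lemma isIso₂_of_isZero {X Y Z : A} {f : X ⟶ Y} {g : Y ⟶ Z} {h : Z ⟶ X⟦(1 : ℤ)⟧}
    (hT : Triangle.mk f g h ∈ distTriang A) (hX : IsZero X) : IsIso g :=
  (Triangle.isZero₁_iff_isIso₂ _ hT).1 hX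

lemma isIso₁_of_isZero {X Y Z : A} {f : X ⟶ Y} {g : Y ⟶ Z} {h : Z ⟶ X⟦(1 : ℤ)⟧}
    (hT : Triangle.mk f g h ∈ distTriang A) (hZ : IsZero Z) : IsIso f :=
  (Triangle.isZero₃_iff_isIso₁ _ hT).1 hZ

lemma adj_aux₁ {B B' : Type*} [Category* B] [Category* B'] {F : B ⥤ B'} {G : B' ⥤ B}
    (adj : F ⊣ G) {X : B} {Y : B'} (f : X ⟶ G.obj Y) :
    adj.unit.app X ≫ G.map (F.map f ≫ adj.counit.app Y) = f := by
  simp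

lemma adj_aux₂ {B B' : Type*} [Category* B] [Category* B'] {F : B ⥤ B'} {G : B' ⥤ B}
    (adj : F ⊣ G) {X : B} {Y : B'} (f : F.obj X ⟶ Y) :
    F.map (adj.unit.app X ≫ G.map f) ≫ adj.counit.app Y = f := by
  simp

end Helpers

/-- Given gluing data endowed with compatible t-structures and
`X ∈ C^{t_C=0}`, the object `X` is obtained from `j_{!*}(j^*X)` via two
extensions by objects of `i_*(D^{t_D=0})`: there are short exact sequences
`0 → K₁ → X → Y → 0` and `0 → j_{!*}(j^*X) → Y → K₂ → 0` in the heart of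
`t_C` with `K₁, K₂ ∈ i_*(D^{t_D=0})`. -/
theorem statement17
    (iS : D ⥤ C) (jU : C ⥤ E) (iU iE : C ⥤ D) (jL jR : E ⥤ C)
    [iS.CommShift ℤ] [jU.CommShift ℤ] [iU.CommShift ℤ] [iE.CommShift ℤ]
    [jL.CommShift ℤ] [jR.CommShift ℤ]
    [iS.IsTriangulated] [jU.IsTriangulated] [iU.IsTriangulated]
    [iE.IsTriangulated] [jL.IsTriangulated] [jR.IsTriangulated]
    (adj₁ : iU ⊣ iS) (adj₂ : iS ⊣ iE) (adj₃ : jL ⊣ jU) (adj₄ : jU ⊣ jR)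
    (hg : GluingCond iS jU iU iE jL jR adj₁ adj₂ adj₃ adj₄)
    (tC : TStructure C) (tD : TStructure D) (tE : TStructure E)
    (hglued : GluedTS jU iU iE tC tD tE)
    (τC : TruncData C tC) [HasImages (THeart C tC)]
    (X : THeart C tC) (X' : THeart E tE)
    (hX' : Nonempty (X'.obj ≅ jU.obj X.obj)) :
    ∃ (K₁ K₂ Y : THeart C tC),
      (∃ Z : D, Z ∈ heartSet D tD ∧ Nonempty (iS.obj Z ≅ K₁.obj)) ∧
      (∃ Z : D, Z ∈ heartSet D tD ∧ Nonempty (iS.obj Z ≅ K₂.obj)) ∧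
      ∃ (a : K₁ ⟶ X) (b : X ⟶ Y) (w₁ : a ≫ b = 0)
        (c : jMiddle jU jL jR adj₃ adj₄ hg.iso₃ τC X' ⟶ Y) (d : Y ⟶ K₂)
        (w₂ : c ≫ d = 0),
        (ShortComplex.mk a b w₁).ShortExact ∧
        (ShortComplex.mk c d w₂).ShortExact := by
  have hfull := hg.full_iS
  have hfaith := hg.faithful_iS
  have i₁ := hg.iso₁
  have i₂ := hg.iso₂
  have i₃ := hg.iso₃
  have i₄ := hg.iso₄
  have leC : ∀ W : C, tC.IsLE W 0 ↔ tE.IsLE (jU.obj W) 0 ∧ tD.IsLE (iU.obj W) 0 := fun W => by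
    simpa only [TStructure.le_iff_isLE] using (hglued W).1
  have geC : ∀ W : C, tC.IsGE W 0 ↔ tE.IsGE (jU.obj W) 0 ∧ tD.IsGE (iE.obj W) 0 := fun W => by
    simpa only [TStructure.ge_iff_isGE] using (hglued W).2
  have hjz : ∀ Z : D, IsZero (jU.obj (iS.obj Z)) := fun Z =>
    (hg.ker_jU _).2 ⟨Z, ⟨Iso.refl _⟩⟩
  have eU : ∀ Z : D, iU.obj (iS.obj Z) ≅ Z := fun Z => asIso (adj₁.counit.app Z)
  have eE : ∀ Z : D, Z ≅ iE.obj (iS.obj Z) := fun Z => asIso (adj₂.unit.app Z)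
  have leU : ∀ (Z : D) (n : ℤ), tD.IsLE Z n → tD.IsLE (iU.obj (iS.obj Z)) n :=
    fun Z n h => tD.isLE_of_iso (eU Z).symm n
  have geE : ∀ (Z : D) (n : ℤ), tD.IsGE Z n → tD.IsGE (iE.obj (iS.obj Z)) n :=
    fun Z n h => tD.isGE_of_iso (eE Z) n
  have iSheart : ∀ Z : D, tD.IsLE Z 0 → tD.IsGE Z 0 → iS.obj Z ∈ heartSet C tC := by
    intro Z h1 h2
    exact ⟨((leC _).2 ⟨tE.isLE_of_isZero (hjz Z) 0, leU Z 0 h1⟩).le,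
      ((geC _).2 ⟨tE.isGE_of_isZero (hjz Z) 0, geE Z 0 h2⟩).ge⟩
  obtain ⟨xle₁, xle₂⟩ := (leC _).1 (heart_isLE X)
  obtain ⟨xge₁, xge₂⟩ := (geC _).1 (heart_isGE X)
  -- the first triangle
  obtain ⟨K, T, hK, hT, u, v, s, hKT⟩ := tD.exists_triangle (iE.obj X.obj) 0 1 (by lia)
  have hK : tD.IsLE K 0 := ⟨hK⟩
  have hT : tD.IsGE T 1 := ⟨hT⟩
  have hK' : tD.IsGE K 0 := isGE₁ tD hKT 0 xge₂ (tD.isGE_of_ge T _ 1)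
  let α : iS.obj K ⟶ X.obj := iS.map u ≫ adj₂.counit.app X.obj
  have hα : adj₂.unit.app K ≫ iE.map α = u := adj_aux₁ adj₂ u
  obtain ⟨Y, β, δ, hY⟩ := distinguished_cocone_triangle α
  obtain ⟨_, hYj⟩ := map_dist jU hY
  obtain ⟨_, hYU⟩ := map_dist iU hY
  obtain ⟨_, hYE⟩ := map_dist iE hY
  have jβ : IsIso (jU.map β) := isIso₂_of_isZero hYj (hjz K)
  have yleU : tD.IsLE (iU.obj Y) 0 :=
    isLE₃ tD hYU 0 (have := leU K 0 hK; tD.isLE_of_le _ 0 _) xle₂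
  have ygeE : tD.IsGE (iE.obj Y) 1 := by
    obtain ⟨e⟩ := cone_iso₃ hKT hYE (asIso (adj₂.unit.app K)) (Iso.refl _) (by
      rw [asIso_hom, hα, Iso.refl_hom, Category.comp_id])
    exact tD.isGE_of_iso e 1
  have yle : tC.IsLE Y 0 := (leC _).2 ⟨tE.isLE_of_iso (asIso (jU.map β)) 0, yleU⟩
  have yge : tC.IsGE Y 0 := (geC _).2 ⟨tE.isGE_of_iso (asIso (jU.map β)) 0,
    tD.isGE_of_ge _ 0 1⟩
  -- the second triangle
  obtain ⟨P, Q, hP, hQ, p, q, r, hPQ⟩ := tD.exists_triangle (iU.obj Y) (-1) 0 (by lia)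
  have hP : tD.IsLE P (-1) := ⟨hP⟩
  have hQ : tD.IsGE Q 0 := ⟨hQ⟩
  have hQ' : tD.IsLE Q 0 := isLE₃ tD hPQ 0 (tD.isLE_of_le P (-1) _) yleU
  let γ : Y ⟶ iS.obj Q := adj₁.unit.app Y ≫ iS.map q
  have hγ : iU.map γ ≫ adj₁.counit.app Q = q := adj_aux₂ adj₁ q
  obtain ⟨M, μ, ε, hM⟩ := distinguished_cocone_triangle₁ γ
  obtain ⟨_, hMj⟩ := map_dist jU hM
  obtain ⟨_, hMU⟩ := map_dist iU hM
  obtain ⟨_, hME⟩ := map_dist iE hM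
  have jμ : IsIso (jU.map μ) := isIso₁_of_isZero hMj (hjz Q)
  have mleU : tD.IsLE (iU.obj M) (-1) := by
    obtain ⟨e⟩ := cone_iso₁ hMU hPQ (Iso.refl _) (asIso (adj₁.counit.app Q)) (by
      rw [asIso_hom, hγ, Iso.refl_hom, Category.id_comp])
    exact tD.isLE_of_iso e.symm (-1)
  have mgeE : tD.IsGE (iE.obj M) 1 :=
    isGE₁ tD hME 1 ygeE (by simpa using geE Q 0 hQ)
  let φ : X'.obj ≅ jU.obj M :=
    hX'.some ≪≫ asIso (jU.map β) ≪≫ (asIso (jU.map μ)).symm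
  have mle : tC.IsLE M 0 := (leC _).2 ⟨have := heart_isLE X'; tE.isLE_of_iso φ 0,
    tD.isLE_of_le _ (-1) 0⟩
  have mge : tC.IsGE M 0 := (geC _).2 ⟨have := heart_isGE X'; tE.isGE_of_iso φ 0,
    tD.isGE_of_ge _ 0 1⟩
  -- the intermediate image
  let a : jL.obj X'.obj ⟶ M := jL.map φ.hom ≫ adj₃.counit.app M
  let b : M ⟶ jR.obj X'.obj := adj₄.unit.app M ≫ jR.map φ.inv
  have hL : tC.IsLE (jL.obj X'.obj) 0 := (leC _).2
    ⟨have : tE.IsLE ((𝟭 E).obj X'.obj) 0 := heart_isLE X'; tE.isLE_of_iso (asIso (adj₃.unit.app X'.obj)) 0,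
      tD.isLE_of_isZero (hg.vanish₁ _) 0⟩
  have hR : tC.IsGE (jR.obj X'.obj) 0 := (geC _).2
    ⟨have : tE.IsGE ((𝟭 E).obj X'.obj) 0 := heart_isGE X'; tE.isGE_of_iso (asIso (adj₄.counit.app X'.obj)).symm 0,
      tD.isGE_of_isZero (hg.vanish₂ _) 0⟩
  have hab : adj₄.homEquiv (jL.obj X'.obj) X'.obj (inv (adj₃.unit.app X'.obj)) = a ≫ b := by
    have h1 : adj₃.unit.app X'.obj ≫ jU.map a = φ.hom := adj_aux₁ adj₃ φ.hom
    have h2 : adj₄.homEquiv _ _ φ.inv = b := adj₄.homEquiv_unit _ _ _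
    rw [← h2, ← adj₄.homEquiv_naturality_left]
    congr 1
    rw [IsIso.inv_eq_of_hom_inv_id]
    rw [← Category.assoc, h1, Iso.hom_inv_id]
  obtain ⟨_, hM1⟩ := hg.tri₁ M
  obtain ⟨_, hM2⟩ := hg.tri₂ M
  have ha : ∀ (W : C), W ∈ heartSet C tC → ∀ g : M ⟶ W, a ≫ g = 0 → g = 0 := by
    intro W hW g hag
    have h1 : adj₃.counit.app M ≫ g = 0 := by
      rw [← cancel_epi (jL.map φ.hom), comp_zero, ← Category.assoc]
      exact hag
    obtain ⟨l, hl⟩ := tri_y2 hM1 g h1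
    have hl0 : l = 0 := by
      apply (adj₂.homEquiv _ _).injective
      have hWE := ((geC W).1 ⟨hW.2⟩).2
      exact (tD.zero_of_isLE_of_isGE _ (-1) 0 (by lia) mleU hWE).trans
        (tD.zero_of_isLE_of_isGE _ (-1) 0 (by lia) mleU hWE).symm
    rw [hl, hl0]
    exact comp_zero
  have hb : ∀ (W : C), W ∈ heartSet C tC → ∀ g : W ⟶ M, g ≫ b = 0 → g = 0 := by
    intro W hW g hgb
    have h1 : g ≫ adj₄.unit.app M = 0 := by
      rw [← cancel_mono (jR.map φ.inv), zero_comp, Category.assoc]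
      exact hgb
    obtain ⟨l, hl⟩ := tri_c2 hM2 g h1
    have hl0 : l = 0 := by
      apply (adj₁.homEquiv _ _).symm.injective
      have hWU := ((leC W).1 ⟨hW.1⟩).2
      exact (tD.zero_of_isLE_of_isGE _ 0 1 (by lia) hWU mgeE).trans
        (tD.zero_of_isLE_of_isGE _ 0 1 (by lia) hWU mgeE).symm
    rw [hl, hl0]
    exact zero_comp
  let M' : THeart C tC := ⟨M, mle.le, mge.ge⟩
  let Y' : THeart C tC := ⟨Y, yle.le, yge.ge⟩
  let K₁ : THeart C tC := ⟨iS.obj K, iSheart K hK hK'⟩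
  let K₂ : THeart C tC := ⟨iS.obj Q, iSheart Q hQ' hQ⟩
  obtain ⟨θ⟩ : Nonempty (jMiddle jU jL jR adj₃ adj₄ hg.iso₃ τC X' ≅ M') := by
    have h := image_iso_of_middle τC M' hL hR a b ha hb
    rw [← hab] at h
    exact h
  obtain ⟨w₁, se₁⟩ := shortExact_of_triangle tC (K := K₁) (X := X) (Y := Y') α β δ hY
  obtain ⟨w₂, se₂⟩ := shortExact_of_triangle tC (K := M') (X := Y') (Y := K₂) μ γ ε hM
  refine ⟨K₁, K₂, Y', ⟨K, ⟨hK.le, hK'.ge⟩, ⟨Iso.refl _⟩⟩, ⟨Q, ⟨hQ'.le, hQ.ge⟩, ⟨Iso.refl _⟩⟩,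
    _, _, w₁, θ.hom ≫ ObjectProperty.homMk μ, _,
    by rw [Category.assoc, w₂, comp_zero], se₁, ?_⟩
  refine ShortComplex.shortExact_of_iso (ShortComplex.isoMk ?_ ?_ ?_ ?_ ?_) se₂
  · exact θ.symm
  · exact Iso.refl _
  · exact Iso.refl _
  · exact (Iso.inv_hom_id_assoc θ _).trans (Category.comp_id _).symm
  · exact (Category.id_comp _).trans (Category.comp_id _).symm

end PaperGluing
end
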